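/- For every edge e = {i,j} ∈ E, ∫ log( w_e / √(w_i·w_j) ) dμ_{v0,A}(w) = Ψ(a_e) − (1/2)·Ψ(b_i) − (1/2)·Ψ(b_j) − log 2, where Ψ = (log Γ)′ is the digamma function. -/

import Mathlib

open MeasureTheory Real Filter
open scoped ENNReal NNReal Classical BigOperators

noncomputable section

namespace ERRW

variable {V : Type*} [Fintype V] [DecidableEq V]

/-- Total weight at a vertex: sum of the edge weights over the edges incident to `i`. -/
def vw (G : SimpleGraph V) [DecidableRel G.Adj] (w : Sym2 V → ℝ) (i : V) : ℝ :=
  ∑ j ∈ G.neighborFinset i, w s(i, j)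

/-- Product of a vertex function over the two endpoints of an unordered pair. -/
def sprod (f : V → ℝ) : Sym2 V → ℝ :=
  Sym2.lift ⟨fun i j => f i * f j, fun i j => mul_comm _ _⟩

/-- Sum of a vertex function over the two endpoints of an unordered pair. -/
def ssum (f : V → ℝ) : Sym2 V → ℝ :=
  Sym2.lift ⟨fun i j => f i + f j, fun i j => add_comm _ _⟩

/-- Quenched transition probability `p_{ij}(w) = w_{ij}/w_i`. -/
def qstep (G : SimpleGraph V) [DecidableRel G.Adj] (w : Sym2 V → ℝ) (i j : V) : ℝ :=
  if G.Adj i j then w s(i, j) / vw G w i else 0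

/-- Stationary distribution `π_i(w) = w_i / Σ_v w_v` of the quenched chain. -/
def statDist (G : SimpleGraph V) [DecidableRel G.Adj] (w : Sym2 V → ℝ) (i : V) : ℝ :=
  vw G w i / ∑ v : V, vw G w v

/-- Spanning trees of `G`, as edge sets. -/
def spanningTrees (G : SimpleGraph V) [DecidableRel G.Adj] : Finset (Finset (Sym2 V)) :=
  G.edgeFinset.powerset.filter fun F =>
    (SimpleGraph.fromEdgeSet (F : Set (Sym2 V))).IsTree

/-- Spanning-tree polynomial `τ(w) = Σ_{T} Π_{e ∈ T} w_e`. -/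
def tau (G : SimpleGraph V) [DecidableRel G.Adj] (w : Sym2 V → ℝ) : ℝ :=
  ∑ F ∈ spanningTrees G, ∏ e ∈ F, w e

/-- Vertex parameter `b_v = (B_v + 1 - 𝟙(v = x))/2`. -/
def bwt (G : SimpleGraph V) [DecidableRel G.Adj] (x : V) (B : Sym2 V → ℝ) (v : V) : ℝ :=
  (vw G B v + 1 - if v = x then 1 else 0) / 2

/-- The normalizing constant `Z_{x,B}` of the magic formula. -/
def Znorm (G : SimpleGraph V) [DecidableRel G.Adj] (x : V) (B : Sym2 V → ℝ) : ℝ :=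
  ((∏ e ∈ G.edgeFinset, Real.Gamma (B e)) /
      ∏ v : V, Real.Gamma (bwt G x B v)) *
    Real.pi ^ (((Fintype.card V : ℝ) - 1) / 2) /
    2 ^ ((1 : ℝ) - (Fintype.card V : ℝ) + ∑ e ∈ G.edgeFinset, B e)

/-- The magic-formula density of `μ_{x,B}` with respect to `Π_{e ≠ e0} dw_e`. -/
def magicDensity (G : SimpleGraph V) [DecidableRel G.Adj] (x : V) (B : Sym2 V → ℝ)
    (w : Sym2 V → ℝ) : ℝ :=
  (Znorm G x B)⁻¹ * (vw G w x) ^ ((1 : ℝ) / 2) *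
      (∏ e ∈ G.edgeFinset, w e ^ (B e - 1)) /
      (∏ v : V, (vw G w v) ^ ((vw G B v + 1) / 2)) *
    Real.sqrt (tau G w)

/-- Coordinates indexed by the non-reference edges. -/
abbrev Epin (G : SimpleGraph V) [DecidableRel G.Adj] (e0 : Sym2 V) :=
  {e : Sym2 V // e ∈ G.edgeFinset ∧ e ≠ e0}

/-- Extension of non-reference edge coordinates to a pinned environment (`w_{e0} = 1`). -/
def pinExt (G : SimpleGraph V) [DecidableRel G.Adj] (e0 : Sym2 V)
    (u : Epin G e0 → ℝ) : Sym2 V → ℝ :=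
  fun e => if e = e0 then 1 else if h : e ∈ G.edgeFinset ∧ e ≠ e0 then u ⟨e, h⟩ else 0

/-- The mixing measure `μ_{x,B}` of the magic formula, as a measure on
environments pinned at the reference edge `e0`. -/
def mixing (G : SimpleGraph V) [DecidableRel G.Adj] (e0 : Sym2 V) (x : V) (B : Sym2 V → ℝ) :
    Measure (Sym2 V → ℝ) :=
  Measure.map (pinExt G e0)
    ((volume : Measure (Epin G e0 → ℝ)).withDensity fun u =>
      ENNReal.ofReal
        (if ∀ e ∈ G.edgeFinset, 0 < pinExt G e0 u e then
          magicDensity G x B (pinExt G e0 u) else 0))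

/-- Kullback–Leibler divergence (natural logarithm), `+∞` if `P` is not
absolutely continuous with respect to `Q`. -/
def KL {Ω : Type*} [MeasurableSpace Ω] (P Q : Measure Ω) : EReal :=
  if P ≪ Q then ((∫ x, Real.log (P.rnDeriv Q x).toReal ∂P : ℝ) : EReal) else ⊤

/-- Edge local time (current edge weight) at time `t` along a path. -/
def localTime (a : Sym2 V → ℝ) (x : ℕ → V) (t : ℕ) (e : Sym2 V) : ℝ :=
  a e + ((Finset.range t).filter fun k => s(x k, x (k + 1)) = e).card

/-- One-step ERRW conditional probability at time `t` given the past of the path. -/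
def errwStep (G : SimpleGraph V) [DecidableRel G.Adj] (a : Sym2 V → ℝ) (x : ℕ → V)
    (t : ℕ) : ℝ :=
  if G.Adj (x t) (x (t + 1)) then
    localTime a x t s(x t, x (t + 1)) /
      ∑ u ∈ G.neighborFinset (x t), localTime a x t s(x t, u)
  else 0

/-- Extension of a finite path to ℕ (junk value `v0` beyond time `T`). -/
def extendPath {T : ℕ} (v0 : V) (x : Fin (T + 1) → V) : ℕ → V :=
  fun t => if h : t < T + 1 then x ⟨t, h⟩ else v0

/-- ERRW trajectory probability of a length-`T` path (the trajectory law mass function). -/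
def errwProb (G : SimpleGraph V) [DecidableRel G.Adj] (v0 : V) (a : Sym2 V → ℝ) (T : ℕ)
    (x : Fin (T + 1) → V) : ℝ :=
  if x 0 = v0 then ∏ t ∈ Finset.range T, errwStep G a (extendPath v0 x) t else 0

/-- Undirected traversal count `N_e` of an edge along a finite path. -/
def edgeCount {T : ℕ} (v0 : V) (x : Fin (T + 1) → V) (e : Sym2 V) : ℕ :=
  ((Finset.range T).filter fun k =>
    s(extendPath v0 x k, extendPath v0 x (k + 1)) = e).card

/-- Quenched path probability of a length-`T` path started at `v0`. -/
def quenchedProb (G : SimpleGraph V) [DecidableRel G.Adj] (v0 : V) (w : Sym2 V → ℝ) (T : ℕ)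
    (x : Fin (T + 1) → V) : ℝ :=
  if x 0 = v0 then
    ∏ t ∈ Finset.range T, qstep G w (extendPath v0 x t) (extendPath v0 x (t + 1))
  else 0

/-- The measure on a finite type determined by a mass function. -/
def discreteMeasure {Ω : Type*} [Fintype Ω] [MeasurableSpace Ω] (p : Ω → ℝ) : Measure Ω :=
  ∑ x : Ω, ENNReal.ofReal (p x) • Measure.dirac x

/-- Digamma function `Ψ = (log Γ)'`. -/
def digamma (x : ℝ) : ℝ := deriv (fun y => Real.log (Real.Gamma y)) x

/-- Trigamma function `Ψ₁ = Ψ'`. -/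
def trigamma (x : ℝ) : ℝ := deriv digamma x

/-- `Λ(p,q) = log Γ(q) − log Γ(p) − (q−p)·Ψ(p)`. -/
def Lam (p q : ℝ) : ℝ :=
  Real.log (Real.Gamma q) - Real.log (Real.Gamma p) - (q - p) * digamma p

/-- The parent map of a rooted functional graph, extended by fixing the root. -/
def parentMap (x : V) (f : {v : V // v ≠ x} → V) (v : V) : V :=
  if h : v ≠ x then f ⟨v, h⟩ else x

/-- Every vertex is eventually sent to the root by the parent map. -/
def ReachesRoot (x : V) (f : {v : V // v ≠ x} → V) : Prop :=
  ∀ v, ∃ n, (parentMap x f)^[n] v = x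

lemma parentMap_of_ne {x : V} (f : {v : V // v ≠ x} → V) (i : {v : V // v ≠ x}) :
    parentMap x f i = f i := by
  simp [parentMap, i.2]

/-- Number of steps of the parent map needed to reach the root. -/
def rootHeight {x : V} {f : {v : V // v ≠ x} → V} (hf : ReachesRoot x f) (v : V) : ℕ :=
  Nat.find (hf v)

lemma rootHeight_parent_lt {x : V} {f : {v : V // v ≠ x} → V} (hf : ReachesRoot x f)
    (i : {v : V // v ≠ x}) : rootHeight hf (f i) < rootHeight hf i := by
  have h := Nat.find_spec (hf i)
  change (parentMap x f)^[rootHeight hf i] i = x at h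
  rcases hn : rootHeight hf i with _ | n
  · rw [hn] at h
    exact absurd h i.2
  · rw [hn, Function.iterate_succ_apply, parentMap_of_ne] at h
    exact Nat.lt_succ_of_le (Nat.find_min' (hf (f i)) h)

/-- The matrix `I - P` of a functional graph with root `x` removed. -/
def functionalMatrix (x : V) (f : {v : V // v ≠ x} → V) :
    Matrix {v : V // v ≠ x} {v : V // v ≠ x} ℝ :=
  fun i j => (if i = j then 1 else 0) - (if f i = j then 1 else 0)

lemma det_functionalMatrix_of_reachesRoot {x : V} {f : {v : V // v ≠ x} → V}
    (hf : ReachesRoot x f) : (functionalMatrix x f).det = 1 := by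
  have hB : (functionalMatrix x f).BlockTriangular
      (fun i => OrderDual.toDual (rootHeight hf i)) := by
    intro i j hij
    have hij' : rootHeight hf i < rootHeight hf j := hij
    have h1 : i ≠ j := by rintro rfl; exact lt_irrefl _ hij'
    have h2 : f i ≠ j := by
      intro h
      have := rootHeight_parent_lt hf i
      rw [h] at this
      omega
    simp [functionalMatrix, h1, h2]
  rw [hB.det]
  refine Finset.prod_eq_one fun k _ => ?_
  have : (functionalMatrix x f).toSquareBlock
      (fun i => OrderDual.toDual (rootHeight hf i)) k = 1 := by
    ext i j
    have h2 : f i ≠ j := by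
      intro h
      have := rootHeight_parent_lt hf i
      rw [h] at this
      have hij : rootHeight hf (i : {v : V // v ≠ x}) = rootHeight hf (j : {v : V // v ≠ x}) :=
        OrderDual.toDual.injective (i.2.trans j.2.symm)
      omega
    simp [functionalMatrix, Matrix.toSquareBlock_def, h2, Matrix.one_apply, Subtype.ext_iff]
  rw [this, Matrix.det_one]

lemma det_functionalMatrix_of_not_reachesRoot {x : V} {f : {v : V // v ≠ x} → V}
    (hf : ¬ ReachesRoot x f) : (functionalMatrix x f).det = 0 := by
  rw [← Matrix.exists_mulVec_eq_zero_iff]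
  let S : V → Prop := fun v => ∀ n, (parentMap x f)^[n] v ≠ x
  have hS : ∀ i : {v : V // v ≠ x}, S i ↔ S (f i) := by
    intro i
    constructor
    · intro h n
      have := h (n + 1)
      rwa [Function.iterate_succ_apply, parentMap_of_ne] at this
    · rintro h (_ | n)
      · exact i.2
      · rw [Function.iterate_succ_apply, parentMap_of_ne]
        exact h n
  refine ⟨fun i => if S i then 1 else 0, ?_, ?_⟩
  · simp only [ReachesRoot, not_forall, not_exists] at hf
    obtain ⟨v, hv⟩ := hf
    intro h
    have := congrFun h ⟨v, hv 0⟩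
    simp only [Pi.zero_apply] at this
    rw [if_pos hv] at this
    exact one_ne_zero this
  · ext i
    have hx : ¬ S x := fun h => h 0 rfl
    simp only [Matrix.mulVec, dotProduct, functionalMatrix, Pi.zero_apply, sub_mul,
      Finset.sum_sub_distrib, ite_mul, one_mul, zero_mul, Finset.sum_ite_eq, Finset.mem_univ,
      if_true]
    by_cases hfi : f i = x
    · have h1 : ¬ S i := by rw [hS, hfi]; exact hx
      rw [if_neg h1, zero_sub, neg_eq_zero]
      refine Finset.sum_eq_zero fun j _ => if_neg ?_
      rw [hfi]
      exact j.2.symm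
    · rw [Finset.sum_eq_single ⟨f i, hfi⟩]
      · simp [hS i]
      · intro j _ hj
        rw [if_neg]
        intro h
        exact hj (Subtype.ext h.symm)
      · simp

/-- The Laplacian of the weighted graph with the row and column of the root removed. -/
def reducedLaplacian (G : SimpleGraph V) [DecidableRel G.Adj] (x : V) (w : Sym2 V → ℝ) :
    Matrix {v : V // v ≠ x} {v : V // v ≠ x} ℝ :=
  fun i j => (if i = j then vw G w i else 0) - (if G.Adj i j then w s((i : V), (j : V)) else 0)

lemma det_reducedLaplacian (G : SimpleGraph V) [DecidableRel G.Adj] (x : V) (w : Sym2 V → ℝ) :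
    (reducedLaplacian G x w).det =
      ∑ f : {v : V // v ≠ x} → V with ((∀ i : {v : V // v ≠ x}, G.Adj i (f i)) ∧ ReachesRoot x f),
        ∏ i : {v : V // v ≠ x}, w s((i : V), f i) := by
  have hrow : reducedLaplacian G x w = fun i : {v : V // v ≠ x} => ∑ k : V,
      (if G.Adj i k then w s((i : V), k) else 0) •
        (fun j : {v : V // v ≠ x} => (if i = j then (1 : ℝ) else 0) - (if k = j then 1 else 0)) := by
    ext i j
    simp only [reducedLaplacian, vw, Finset.sum_apply, Pi.smul_apply, smul_eq_mul, mul_sub,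
      Finset.sum_sub_distrib, mul_ite, mul_one, mul_zero, Finset.sum_ite_eq', Finset.mem_univ,
      if_true]
    congr 1
    · split_ifs
      · rw [← Finset.sum_filter]
        refine Finset.sum_congr ?_ fun _ _ => rfl
        ext k; simp
      · simp
  have hdet : (reducedLaplacian G x w).det = ∑ f : {v : V // v ≠ x} → V,
      (∏ i : {v : V // v ≠ x}, if G.Adj i (f i) then w s((i : V), f i) else 0) * (functionalMatrix x f).det := by
    have h := (Matrix.detRowAlternating (n := {v : V // v ≠ x}) (R := ℝ)).toMultilinearMap.map_sum
      (fun (i : {v : V // v ≠ x}) (k : V) => (if G.Adj i k then w s((i : V), k) else 0) •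
        (fun j : {v : V // v ≠ x} => (if i = j then (1 : ℝ) else 0) - (if k = j then 1 else 0)))
    rw [← hrow] at h
    refine h.trans (Finset.sum_congr rfl fun f _ => ?_)
    rw [MultilinearMap.map_smul_univ]
    rfl
  rw [hdet, Finset.sum_filter]
  refine Finset.sum_congr rfl fun f _ => ?_
  by_cases hf : ReachesRoot x f
  · rw [det_functionalMatrix_of_reachesRoot hf, mul_one]
    by_cases ha : ∀ i : {v : V // v ≠ x}, G.Adj i (f i)
    · rw [if_pos ⟨ha, hf⟩]
      exact Finset.prod_congr rfl fun i _ => if_pos (ha i)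
    · rw [if_neg (fun h => ha h.1)]
      push Not at ha
      obtain ⟨i, hi⟩ := ha
      exact Finset.prod_eq_zero (Finset.mem_univ i) (if_neg hi)
  · rw [det_functionalMatrix_of_not_reachesRoot hf, mul_zero, if_neg (fun h => hf h.2)]

/-- The edges `{v, f v}` of a functional graph. -/
def parentEdges (x : V) (f : {v : V // v ≠ x} → V) : Finset (Sym2 V) :=
  Finset.univ.image fun i : {v : V // v ≠ x} => s((i : V), f i)

lemma parentEdges_injective {x : V} {f : {v : V // v ≠ x} → V} (hf : ReachesRoot x f) :
    Function.Injective fun i : {v : V // v ≠ x} => s((i : V), f i) := by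
  intro i j hij
  by_contra hne
  rcases Sym2.eq_iff.1 hij with ⟨h, _⟩ | ⟨h1, h2⟩
  · exact hne (Subtype.ext h)
  · have a1 := rootHeight_parent_lt hf i
    have a2 := rootHeight_parent_lt hf j
    rw [h2] at a1
    rw [← h1] at a2
    omega

lemma card_parentEdges {x : V} {f : {v : V // v ≠ x} → V} (hf : ReachesRoot x f) :
    (parentEdges x f).card + 1 = Fintype.card V := by
  rw [parentEdges, Finset.card_image_of_injective _ (parentEdges_injective hf), Finset.card_univ,
    Fintype.card_subtype_compl, Fintype.card_subtype_eq]
  have := Fintype.card_pos_iff.2 ⟨x⟩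
  omega

lemma isTree_parentEdges {x : V} {f : {v : V // v ≠ x} → V} (hf : ReachesRoot x f)
    (hne : ∀ i : {v : V // v ≠ x}, (i : V) ≠ f i) :
    (SimpleGraph.fromEdgeSet (parentEdges x f : Set (Sym2 V))).IsTree := by
  rw [SimpleGraph.isTree_iff_connected_and_card]
  set T := SimpleGraph.fromEdgeSet (parentEdges x f : Set (Sym2 V)) with hT
  have hadj : ∀ i : {v : V // v ≠ x}, T.Adj i (f i) := by
    intro i
    rw [hT, SimpleGraph.fromEdgeSet_adj]
    exact ⟨Finset.mem_coe.2 (Finset.mem_image_of_mem _ (Finset.mem_univ i)), hne i⟩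
  have hreach : ∀ v, T.Reachable v x := by
    intro v
    induction hn : rootHeight hf v using Nat.strong_induction_on generalizing v with
    | _ n ih =>
      by_cases hv : v = x
      · rw [hv]
      · have := rootHeight_parent_lt hf ⟨v, hv⟩
        exact (hadj ⟨v, hv⟩).reachable.trans (ih _ (by rw [← hn]; exact this) _ rfl)
  have : Nonempty V := ⟨x⟩
  refine ⟨⟨fun u v => (hreach u).trans (hreach v).symm⟩, ?_⟩
  have hE : T.edgeSet = (parentEdges x f : Set (Sym2 V)) := by
    rw [hT, SimpleGraph.edgeSet_fromEdgeSet, sdiff_eq_left, Set.disjoint_left]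
    intro e he
    simp only [parentEdges, Finset.coe_image, Finset.coe_univ, Set.image_univ, Set.mem_range] at he
    obtain ⟨i, rfl⟩ := he
    simpa using hne i
  rw [hE, Nat.card_eq_fintype_card, Nat.card_eq_fintype_card]
  simpa using card_parentEdges hf

/-- The matrix-tree theorem for the reduced Laplacian. -/
theorem tau_eq_det_reducedLaplacian (G : SimpleGraph V) [DecidableRel G.Adj] (x : V)
    (w : Sym2 V → ℝ) : tau G w = (reducedLaplacian G x w).det := by
  rw [det_reducedLaplacian, tau]
  symm
  refine Finset.sum_nbij (parentEdges x) ?_ ?_ ?_ ?_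
  · intro f hf
    obtain ⟨ha, hr⟩ := (Finset.mem_filter.1 hf).2
    rw [spanningTrees, Finset.mem_filter, Finset.mem_powerset]
    refine ⟨?_, isTree_parentEdges hr fun i => (ha i).ne⟩
    intro e he
    obtain ⟨i, _, rfl⟩ := Finset.mem_image.1 he
    simpa using ha i
  · intro f hf g hg hfg
    obtain ⟨ha, hr⟩ := (Finset.mem_filter.1 hf).2
    obtain ⟨hb, hs⟩ := (Finset.mem_filter.1 hg).2
    by_contra hne
    obtain ⟨i, hi⟩ := Function.ne_iff.1 hne
    have step : ∀ i, f i ≠ g i → ∃ h : f i ≠ x, f ⟨f i, h⟩ ≠ g ⟨f i, h⟩ := by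
      intro i hi
      have hmem : s((i : V), f i) ∈ parentEdges x g := by
        rw [← hfg]
        exact Finset.mem_image_of_mem _ (Finset.mem_univ i)
      obtain ⟨j, _, hj⟩ := Finset.mem_image.1 hmem
      rcases Sym2.eq_iff.1 hj with ⟨h1, h2⟩ | ⟨h1, h2⟩
      · obtain rfl : j = i := Subtype.ext h1
        exact absurd h2.symm hi
      · have hx : f i ≠ x := h1 ▸ j.2
        obtain rfl : j = ⟨f i, hx⟩ := Subtype.ext h1
        refine ⟨hx, ?_⟩
        rw [h2]
        intro h3
        have a1 := rootHeight_parent_lt hr i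
        have a2 := rootHeight_parent_lt hr ⟨f i, hx⟩
        rw [h3] at a2
        exact absurd a2 (not_lt.2 a1.le)
    have hall : ∀ n, ∃ h : (parentMap x f)^[n] i ≠ x,
        f ⟨(parentMap x f)^[n] i, h⟩ ≠ g ⟨(parentMap x f)^[n] i, h⟩ := by
      intro n
      induction n with
      | zero => exact ⟨i.2, hi⟩
      | succ n ih =>
        obtain ⟨h, h'⟩ := ih
        have := step _ h'
        rw [Function.iterate_succ_apply']
        have e : parentMap x f ((parentMap x f)^[n] i) = f ⟨(parentMap x f)^[n] i, h⟩ :=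
          parentMap_of_ne f ⟨_, h⟩
        simpa only [e] using this
    obtain ⟨n, hn⟩ := hr i
    exact (hall n).1 hn
  · intro F hF
    have hF' : F ∈ spanningTrees G := hF
    rw [spanningTrees, Finset.mem_filter, Finset.mem_powerset] at hF'
    obtain ⟨hsub, htree⟩ := hF'
    set T := SimpleGraph.fromEdgeSet (F : Set (Sym2 V)) with hT
    have hstep : ∀ i : {v : V // v ≠ x}, ∃ k, T.Adj i k ∧ T.dist k x < T.dist i x := by
      intro i
      obtain ⟨i, hi⟩ := i
      obtain ⟨p, hp⟩ := htree.connected.exists_walk_length_eq_dist i x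
      cases p with
      | nil => exact absurd rfl hi
      | @cons _ k _ h q =>
        refine ⟨k, h, ?_⟩
        rw [← hp, SimpleGraph.Walk.length_cons]
        exact Nat.lt_succ_of_le (SimpleGraph.dist_le q)
    choose f hf1 hf2 using hstep
    have hr : ReachesRoot x f := by
      intro v
      induction hn : T.dist v x using Nat.strong_induction_on generalizing v with
      | _ n ih =>
        by_cases hv : v = x
        · exact ⟨0, hv⟩
        · obtain ⟨m, hm⟩ := ih _ (by rw [← hn]; exact hf2 ⟨v, hv⟩) _ rfl
          exact ⟨m + 1, by
            rw [Function.iterate_succ_apply, parentMap_of_ne f ⟨v, hv⟩]; exact hm⟩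
    have hFf : ∀ i : {v : V // v ≠ x}, s((i : V), f i) ∈ F := by
      intro i
      have := hf1 i
      rw [hT, SimpleGraph.fromEdgeSet_adj] at this
      exact this.1
    refine ⟨f, ?_, ?_⟩
    · rw [Finset.mem_coe, Finset.mem_filter]
      refine ⟨Finset.mem_univ _, fun i => ?_, hr⟩
      simpa using hsub (hFf i)
    · refine Finset.eq_of_subset_of_card_le ?_ ?_
      · intro e he
        obtain ⟨i, _, rfl⟩ := Finset.mem_image.1 he
        exact hFf i
      · have h1 := card_parentEdges hr
        have h2 := (SimpleGraph.isTree_iff_connected_and_card.1 htree).2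
        have hE : T.edgeSet = (F : Set (Sym2 V)) := by
          rw [hT, SimpleGraph.edgeSet_fromEdgeSet, sdiff_eq_left, Set.disjoint_left]
          intro e he hd
          exact G.not_isDiag_of_mem_edgeFinset (hsub he) (by simpa using hd)
        rw [hE, Nat.card_eq_fintype_card, Nat.card_eq_fintype_card] at h2
        have h3 : F.card + 1 = Fintype.card V := by simpa using h2
        omega
  · intro f hf
    obtain ⟨ha, hr⟩ := (Finset.mem_filter.1 hf).2
    rw [parentEdges, Finset.prod_image (parentEdges_injective hr).injOn]

lemma lintegral_exp_neg_sq_half :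
    ∫⁻ x : ℝ, ENNReal.ofReal (exp (-(x ^ 2) / 2)) = ENNReal.ofReal (√(2 * π)) := by
  have h := integral_gaussian (1 / 2)
  have hi := integrable_exp_neg_mul_sq (b := 1 / 2) (by norm_num)
  rw [show π / (1 / 2) = 2 * π by ring] at h
  rw [← h, ofReal_integral_eq_lintegral_ofReal hi (ae_of_all _ fun x => (exp_pos _).le)]
  refine lintegral_congr fun x => ?_
  congr 2
  ring

/-- The inverse-Gaussian normalization in logarithmic coordinates. -/
lemma lintegral_inverseGaussian {s : ℝ} (hs : 0 < s) :
    ∫⁻ t : ℝ, ENNReal.ofReal (exp (-t / 2) * exp (-(exp (-t / 2) - s * exp (t / 2)) ^ 2 / 2)) =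
      ENNReal.ofReal (√(2 * π)) := by
  set g : ℝ → ℝ := fun t => s * exp (t / 2) - exp (-t / 2) with hg
  set g' : ℝ → ℝ := fun t => (s * exp (t / 2) + exp (-t / 2)) / 2 with hg'
  have hgc : Continuous g := by fun_prop
  have hderiv : ∀ t, HasDerivAt g (g' t) t := by
    intro t
    have h1 : HasDerivAt (fun t : ℝ => exp (t / 2)) (exp (t / 2) * (1 / 2)) t :=
      ((hasDerivAt_id t).div_const 2).exp
    have h2 : HasDerivAt (fun t : ℝ => exp (-t / 2)) (exp (-t / 2) * (-1 / 2)) t :=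
      ((hasDerivAt_id t).neg.div_const 2).exp
    refine ((h1.const_mul s).sub h2).congr_deriv ?_
    simp only [hg']
    ring
  have hmono : StrictMono g := by
    intro a b hab
    have h1 : exp (a / 2) < exp (b / 2) := exp_lt_exp.2 (by linarith)
    have h2 : exp (-b / 2) < exp (-a / 2) := exp_lt_exp.2 (by linarith)
    have h3 := mul_lt_mul_of_pos_left h1 hs
    simp only [hg]
    linarith
  have htop : Tendsto g atTop atTop := by
    refine Filter.tendsto_atTop_add_right_of_le' _ (-1) ?_ ?_
    · exact (tendsto_exp_atTop.comp (tendsto_id.atTop_div_const two_pos)).const_mul_atTop hs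
    · filter_upwards [eventually_ge_atTop 0] with t ht
      have : exp (-t / 2) ≤ 1 := exp_le_one_iff.2 (by linarith)
      linarith
  have hbot : Tendsto g atBot atBot := by
    have h1 : Tendsto (fun t : ℝ => exp (-t / 2)) atBot atTop :=
      tendsto_exp_atTop.comp (tendsto_neg_atBot_atTop.atTop_div_const two_pos)
    have h2 : Tendsto (fun t : ℝ => -exp (-t / 2)) atBot atBot := tendsto_neg_atTop_atBot.comp h1
    refine (Filter.tendsto_atBot_add_left_of_ge' atBot s (f := fun t => s * exp (t / 2))
      (g := fun t => -exp (-t / 2)) ?_ h2).congr fun t => ?_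
    · filter_upwards [eventually_le_atBot 0] with t ht
      have : exp (t / 2) ≤ 1 := exp_le_one_iff.2 (by linarith)
      nlinarith
    · simp only [hg]; ring
  have hsurj : g '' Set.univ = Set.univ := by
    rw [Set.image_univ]
    exact (hgc.surjective htop hbot).range_eq
  have hsub := lintegral_image_eq_lintegral_abs_deriv_mul (f := g) (f' := g') MeasurableSet.univ
    (fun t _ => (hderiv t).hasDerivWithinAt) hmono.injective.injOn
    (fun x => ENNReal.ofReal (exp (-(x ^ 2) / 2)))
  rw [hsurj, Measure.restrict_univ, lintegral_exp_neg_sq_half] at hsub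
  set K := ∫⁻ t : ℝ, ENNReal.ofReal
    (exp (-t / 2) * exp (-(exp (-t / 2) - s * exp (t / 2)) ^ 2 / 2)) with hK
  have hrefl : ∫⁻ t : ℝ, ENNReal.ofReal
      (s * exp (t / 2) * exp (-(exp (-t / 2) - s * exp (t / 2)) ^ 2 / 2)) = K := by
    rw [← lintegral_sub_left_eq_self _ (-2 * log s)]
    refine lintegral_congr fun t => ?_
    have e1 : s * exp ((-2 * log s - t) / 2) = exp (-t / 2) := by
      rw [show (-2 * log s - t) / 2 = -log s + -t / 2 by ring, exp_add, exp_neg, exp_log hs]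
      field_simp
    have e2 : exp (-(-2 * log s - t) / 2) = s * exp (t / 2) := by
      rw [show -(-2 * log s - t) / 2 = log s + t / 2 by ring, exp_add, exp_log hs]
    rw [e1, e2, ← neg_sub (exp (-t / 2)), neg_sq]
  have hadd : 2 * K = 2 * ENNReal.ofReal (√(2 * π)) := by
    rw [two_mul, hsub]
    nth_rewrite 2 [← hrefl]
    rw [hK, ← lintegral_add_left (by fun_prop), ← lintegral_const_mul _ (by fun_prop)]
    refine lintegral_congr fun t => ?_
    rw [← ENNReal.ofReal_add (by positivity) (by positivity),
      ← ENNReal.ofReal_mul (by positivity), show (2 : ℝ≥0∞) = ENNReal.ofReal 2 by simp,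
      ← ENNReal.ofReal_mul (by positivity)]
    congr 1
    have hp : 0 < g' t := by simp only [hg']; positivity
    rw [abs_of_pos hp]
    simp only [hg, hg']
    rw [← neg_sub (exp (-t / 2)), neg_sq]
    ring
  exact (ENNReal.mul_right_inj (by simp) (by simp)).1 hadd

section Susy

variable {ι : Type*} [Fintype ι] [DecidableEq ι]

/-- The matrix `H_β` in the horospherical coordinates of the hyperbolic sigma model, with
interactions `W` and pinning `η`. -/
def susyMatrix (W : ι → ι → ℝ) (η u : ι → ℝ) : Matrix ι ι ℝ :=
  fun i j => (if i = j then (∑ k, W i k * exp (u k - u i)) + η i * exp (-u i) else 0) - W i j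

/-- The energy of the hyperbolic sigma model with interactions `W` and pinning `η`. -/
def susyEnergy (W : ι → ι → ℝ) (η u : ι → ℝ) : ℝ :=
  (∑ i, ∑ j, W i j * (exp (u j - u i) - 1)) / 2 + ∑ i, η i * ((exp (u i) + exp (-u i)) / 2 - 1)

/-- Every nonempty set of sites is linked to its complement or to the pinning. -/
def PinConnected (W : ι → ι → ℝ) (η : ι → ℝ) : Prop :=
  ∀ S : Finset ι, S.Nonempty → ∃ i ∈ S, 0 < η i ∨ ∃ j ∉ S, 0 < W i j

/-- The density of the hyperbolic sigma model (without the factor `(2π)^{-n/2}`). -/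
def susyDensity (W : ι → ι → ℝ) (η u : ι → ℝ) : ℝ :=
  exp (-susyEnergy W η u) * √(susyMatrix W η u).det

/-- Interactions after elimination of the site `0` at parameter `t`. -/
def elimW {n : ℕ} (W : Fin (n + 1) → Fin (n + 1) → ℝ) (t : ℝ) (i j : Fin n) : ℝ :=
  W i.succ j.succ + W 0 i.succ * W 0 j.succ * exp t

/-- Pinning after elimination of the site `0` at parameter `t`. -/
def elimEta {n : ℕ} (W : Fin (n + 1) → Fin (n + 1) → ℝ) (η : Fin (n + 1) → ℝ) (t : ℝ)
    (i : Fin n) : ℝ :=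
  η i.succ + W 0 i.succ * η 0 * exp t

variable {n : ℕ} {W : Fin (n + 1) → Fin (n + 1) → ℝ} {η : Fin (n + 1) → ℝ}

lemma PinConnected.elim (h : PinConnected W η) (hs : ∀ i j, W i j = W j i)
    (hW : ∀ i j, 0 ≤ W i j) (hη : ∀ i, 0 ≤ η i) (t : ℝ) :
    PinConnected (elimW W t) (elimEta W η t) := by
  intro S hS
  have hE := exp_pos t
  have key : ∀ i ∈ S, 0 < W i.succ 0 →
      ∃ i ∈ S, 0 < elimEta W η t i ∨ ∃ j ∉ S, 0 < elimW W t i j := by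
    intro i hi hi0
    rw [hs] at hi0
    obtain ⟨k, hk, hk'⟩ := h (insert 0 (S.image Fin.succ)) (Finset.insert_nonempty _ _)
    rcases Finset.mem_insert.1 hk with rfl | hk
    · refine ⟨i, hi, ?_⟩
      rcases hk' with hk' | ⟨j, hj, hj'⟩
      · left
        have := hη i.succ
        unfold elimEta
        positivity
      · right
        rw [Finset.mem_insert, not_or] at hj
        obtain ⟨j, rfl⟩ := Fin.exists_succ_eq.2 hj.1
        refine ⟨j, fun h => hj.2 (Finset.mem_image_of_mem _ h), ?_⟩
        have := hW i.succ j.succ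
        unfold elimW
        positivity
    · obtain ⟨i, hi, rfl⟩ := Finset.mem_image.1 hk
      refine ⟨i, hi, ?_⟩
      rcases hk' with hk' | ⟨j, hj, hj'⟩
      · left
        have h1 := hη 0
        have h2 := hW 0 i.succ
        unfold elimEta
        positivity
      · right
        rw [Finset.mem_insert, not_or] at hj
        obtain ⟨j, rfl⟩ := Fin.exists_succ_eq.2 hj.1
        refine ⟨j, fun h => hj.2 (Finset.mem_image_of_mem _ h), ?_⟩
        have h1 := hW 0 i.succ
        have h2 := hW 0 j.succ
        unfold elimW
        positivity
  obtain ⟨k, hk, hk'⟩ := h (S.image Fin.succ) (hS.image _)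
  obtain ⟨i, hi, rfl⟩ := Finset.mem_image.1 hk
  rcases hk' with hk' | ⟨j, hj, hj'⟩
  · refine ⟨i, hi, Or.inl ?_⟩
    have h1 := hη 0
    have h2 := hW 0 i.succ
    unfold elimEta
    positivity
  · rcases Fin.eq_zero_or_eq_succ j with rfl | ⟨j, rfl⟩
    · exact key i hi hj'
    · refine ⟨i, hi, Or.inr ⟨j, fun h => hj (Finset.mem_image_of_mem _ h), ?_⟩⟩
      have h1 := hW 0 i.succ
      have h2 := hW 0 j.succ
      unfold elimW
      positivity

lemma PinConnected.sum_pos (h : PinConnected W η) (hW : ∀ i j, 0 ≤ W i j) (hη : ∀ i, 0 ≤ η i)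
    {p : Fin n → ℝ} (hp : ∀ i, 0 < p i) : 0 < (∑ j : Fin n, W 0 j.succ * p j) + η 0 := by
  have hnn : ∀ j ∈ (Finset.univ : Finset (Fin n)), 0 ≤ W 0 j.succ * p j :=
    fun j _ => mul_nonneg (hW _ _) (hp j).le
  obtain ⟨i, hi, hi'⟩ := h {0} (Finset.singleton_nonempty _)
  rw [Finset.mem_singleton] at hi
  subst hi
  rcases hi' with hi' | ⟨j, hj, hj'⟩
  · exact add_pos_of_nonneg_of_pos (Finset.sum_nonneg hnn) hi'
  · rw [Finset.mem_singleton] at hj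
    obtain ⟨j, rfl⟩ := Fin.exists_succ_eq.2 hj
    refine add_pos_of_pos_of_nonneg ?_ (hη 0)
    exact Finset.sum_pos' hnn ⟨j, Finset.mem_univ _, mul_pos hj' (hp j)⟩

lemma susyMatrix_cons_zero_zero (u : Fin n → ℝ) (t : ℝ)
    (hc : 0 < (∑ j : Fin n, W 0 j.succ * exp (u j)) + η 0) :
    susyMatrix W η (Fin.cons (t + log ((∑ j : Fin n, W 0 j.succ * exp (u j)) + η 0)) u) 0 0 =
      exp (-t) := by
  set c := (∑ j : Fin n, W 0 j.succ * exp (u j)) + η 0 with hcdef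
  have h1 : ∑ j : Fin n, W 0 j.succ * exp (u j - (t + log c)) =
      (∑ j : Fin n, W 0 j.succ * exp (u j)) * (exp (-t) / c) := by
    rw [Finset.sum_mul]
    refine Finset.sum_congr rfl fun j _ => ?_
    rw [exp_sub, exp_add, exp_log hc, exp_neg]
    field_simp
  simp only [susyMatrix, if_true, Fin.sum_univ_succ, Fin.cons_zero, Fin.cons_succ, sub_self,
    exp_zero, h1]
  rw [show -(t + log c) = -t - log c by ring, exp_sub, exp_log hc,
    show (∑ j : Fin n, W 0 j.succ * exp (u j)) = c - η 0 by rw [hcdef]; ring]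
  field_simp
  ring

lemma det_susyMatrix_cons (hs : ∀ i j, W i j = W j i) (u : Fin n → ℝ) (t : ℝ)
    (hc : 0 < (∑ j : Fin n, W 0 j.succ * exp (u j)) + η 0) :
    (susyMatrix W η (Fin.cons (t + log ((∑ j : Fin n, W 0 j.succ * exp (u j)) + η 0)) u)).det =
      exp (-t) * (susyMatrix (elimW W t) (elimEta W η t) u).det := by
  have h00 := susyMatrix_cons_zero_zero u t hc
  set c := (∑ j : Fin n, W 0 j.succ * exp (u j)) + η 0 with hcdef
  set M := susyMatrix W η (Fin.cons (t + log c) u) with hM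
  have hi0 : ∀ i : Fin n, M i.succ 0 = -W 0 i.succ := by
    intro i
    simp [hM, susyMatrix, hs i.succ 0]
  have h0i : ∀ i : Fin n, M 0 i.succ = -W 0 i.succ := by
    intro i
    simp [hM, susyMatrix, (Fin.succ_ne_zero i).symm]
  set N : Matrix (Fin (n + 1)) (Fin (n + 1)) ℝ :=
    fun i j => M i j + (Fin.cases 0 (fun k => W 0 k.succ * exp t) i : ℝ) * M 0 j with hN
  have hdet : N.det = M.det :=
    Matrix.det_eq_of_forall_row_eq_smul_add_const
      (fun i => (Fin.cases 0 (fun k => W 0 k.succ * exp t) i : ℝ)) 0 rfl fun i j => rfl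
  have hN0 : ∀ i : Fin n, N i.succ 0 = 0 := by
    intro i
    simp only [hN, Fin.cases_succ, hi0, h00, exp_neg]
    field_simp
    ring
  have hN00 : N 0 0 = exp (-t) := by simp [hN, h00]
  have hsub : N.submatrix (Fin.succAbove 0) Fin.succ =
      susyMatrix (elimW W t) (elimEta W η t) u := by
    ext i j
    have hNij : N i.succ j.succ = M i.succ j.succ + W 0 i.succ * exp t * M 0 j.succ := rfl
    rw [Matrix.submatrix_apply, Fin.zero_succAbove, hNij, h0i]
    have hX : exp (t + log c - u i) = c * exp t * exp (-u i) := by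
      rw [show t + log c - u i = t + (log c + -u i) by ring, exp_add, exp_add, exp_log hc]
      ring
    by_cases hij : i = j
    · subst hij
      have hsum : ∑ k : Fin n, elimW W t i k * exp (u k - u i) =
          (∑ k : Fin n, W i.succ k.succ * exp (u k - u i)) +
            W 0 i.succ * exp t * exp (-u i) * ∑ k : Fin n, W 0 k.succ * exp (u k) := by
        rw [Finset.mul_sum, ← Finset.sum_add_distrib]
        refine Finset.sum_congr rfl fun k _ => ?_
        rw [elimW, sub_eq_add_neg, exp_add]
        ring
      rw [hM]
      simp only [susyMatrix, if_true, Fin.sum_univ_succ (n := n), Fin.cons_zero, Fin.cons_succ, hX,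
        hsum, hs i.succ 0]
      rw [show (∑ k : Fin n, W 0 k.succ * exp (u k)) = c - η 0 by rw [hcdef]; ring, elimW, elimEta]
      ring
    · have hij' : i.succ ≠ j.succ := fun h => hij (Fin.succ_injective _ h)
      rw [hM]
      simp only [susyMatrix, if_neg hij, if_neg hij', elimW]
      ring
  rw [← hdet, Matrix.det_succ_column_zero, Fin.sum_univ_succ, hsub, hN00]
  simp [hN0]

lemma susyEnergy_cons (hs : ∀ i j, W i j = W j i) (u : Fin n → ℝ) (t : ℝ)
    (hc : 0 < (∑ j : Fin n, W 0 j.succ * exp (u j)) + η 0) :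
    susyEnergy W η (Fin.cons (t + log ((∑ j : Fin n, W 0 j.succ * exp (u j)) + η 0)) u) =
      susyEnergy (elimW W t) (elimEta W η t) u +
        (exp (-t / 2) - ((∑ j : Fin n, W 0 j.succ) + η 0) * exp (t / 2)) ^ 2 / 2 := by
  set A := ∑ j : Fin n, W 0 j.succ * exp (u j) with hA
  set B := ∑ j : Fin n, W 0 j.succ * exp (-u j) with hB
  set P := ∑ j : Fin n, W 0 j.succ with hP
  set c := A + η 0 with hcdef
  have hX : exp (t + log c) = c * exp t := by
    rw [exp_add, exp_log hc]; ring
  have hX' : exp (-(t + log c)) = exp (-t) / c := by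
    rw [neg_add, exp_add, exp_neg (log c), exp_log hc]; rfl
  have h1 : ∑ j : Fin n, W 0 j.succ * (exp (u j - (t + log c)) - 1) =
      A * (exp (-t) / c) - P := by
    rw [hA, hP, Finset.sum_mul, ← Finset.sum_sub_distrib]
    refine Finset.sum_congr rfl fun j _ => ?_
    rw [sub_eq_add_neg (u j), exp_add, hX']
    ring
  have h2 : ∑ j : Fin n, W j.succ 0 * (exp (t + log c - u j) - 1) = B * (c * exp t) - P := by
    rw [hB, hP, Finset.sum_mul, ← Finset.sum_sub_distrib]
    refine Finset.sum_congr rfl fun j _ => ?_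
    rw [sub_eq_add_neg (t + log c), exp_add, hX, hs]
    ring
  have h3 : ∑ i : Fin n, ∑ j : Fin n, elimW W t i j * (exp (u j - u i) - 1) =
      (∑ i : Fin n, ∑ j : Fin n, W i.succ j.succ * (exp (u j - u i) - 1)) +
        exp t * (A * B - P * P) := by
    rw [mul_comm A B, hA, hB, hP, Finset.sum_mul_sum, Finset.sum_mul_sum, ← Finset.sum_sub_distrib,
      Finset.mul_sum, ← Finset.sum_add_distrib]
    refine Finset.sum_congr rfl fun i _ => ?_
    rw [← Finset.sum_sub_distrib, Finset.mul_sum, ← Finset.sum_add_distrib]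
    refine Finset.sum_congr rfl fun j _ => ?_
    rw [elimW, sub_eq_add_neg (u j), exp_add]
    ring
  have h4 : ∑ i : Fin n, elimEta W η t i * ((exp (u i) + exp (-u i)) / 2 - 1) =
      (∑ i : Fin n, η i.succ * ((exp (u i) + exp (-u i)) / 2 - 1)) +
        exp t * η 0 * ((A + B) / 2 - P) := by
    rw [hA, hB, hP, ← Finset.sum_add_distrib, Finset.sum_div, ← Finset.sum_sub_distrib,
      Finset.mul_sum, ← Finset.sum_add_distrib]
    refine Finset.sum_congr rfl fun i _ => ?_
    rw [elimEta]
    ring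
  have h5 : (exp (-t / 2) - (P + η 0) * exp (t / 2)) ^ 2 =
      exp (-t) - 2 * (P + η 0) + (P + η 0) ^ 2 * exp t := by
    have e1 : exp (-t / 2) ^ 2 = exp (-t) := by rw [← exp_nat_mul]; congr 1; push_cast; ring
    have e2 : exp (t / 2) ^ 2 = exp t := by rw [← exp_nat_mul]; congr 1; push_cast; ring
    have e3 : exp (-t / 2) * exp (t / 2) = 1 := by rw [← exp_add, ← exp_zero]; congr 1; ring
    linear_combination e1 + (P + η 0) ^ 2 * e2 - 2 * (P + η 0) * e3
  have hsum : ∑ i : Fin n, (W i.succ 0 * (exp (t + log c - u i) - 1) +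
      ∑ j : Fin n, W i.succ j.succ * (exp (u j - u i) - 1)) = (B * (c * exp t) - P) +
      ∑ i : Fin n, ∑ j : Fin n, W i.succ j.succ * (exp (u j - u i) - 1) := by
    rw [Finset.sum_add_distrib, h2]
  simp only [susyEnergy, h5, h3, h4]
  simp only [Fin.sum_univ_succ (n := n), Fin.cons_zero, Fin.cons_succ, h1, hsum, hX, hX',
    sub_self, exp_zero, mul_zero, zero_add]
  have hA' : A = c - η 0 := by rw [hcdef]; ring
  rw [hA']
  field_simp
  ring

lemma susyDensity_cons (hs : ∀ i j, W i j = W j i) (u : Fin n → ℝ) (t : ℝ)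
    (hc : 0 < (∑ j : Fin n, W 0 j.succ * exp (u j)) + η 0) :
    susyDensity W η (Fin.cons (t + log ((∑ j : Fin n, W 0 j.succ * exp (u j)) + η 0)) u) =
      (exp (-t / 2) *
        exp (-(exp (-t / 2) - ((∑ j : Fin n, W 0 j.succ) + η 0) * exp (t / 2)) ^ 2 / 2)) *
        susyDensity (elimW W t) (elimEta W η t) u := by
  rw [susyDensity, susyDensity, susyEnergy_cons hs u t hc, det_susyMatrix_cons hs u t hc,
    sqrt_mul (exp_pos _).le, ← exp_half, neg_add, exp_add, neg_div]
  ring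

lemma continuous_susyDensity {T : Type*} [TopologicalSpace T] {W : T → ι → ι → ℝ}
    {η u : T → ι → ℝ} (hW : Continuous W) (hη : Continuous η) (hu : Continuous u) :
    Continuous fun p => susyDensity (W p) (η p) (u p) := by
  have hW' : ∀ i j, Continuous fun p => W p i j := fun i j => by fun_prop
  have hη' : ∀ i, Continuous fun p => η p i := fun i => by fun_prop
  have hu' : ∀ i, Continuous fun p => u p i := fun i => by fun_prop
  have hdet : Continuous fun p => (susyMatrix (W p) (η p) (u p)).det := by
    refine Continuous.matrix_det (continuous_matrix fun i j => ?_)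
    unfold susyMatrix
    split_ifs <;> fun_prop
  unfold susyDensity susyEnergy
  fun_prop

theorem lintegral_susyDensity_fin : ∀ (n : ℕ) (W : Fin n → Fin n → ℝ) (η : Fin n → ℝ),
    (∀ i j, W i j = W j i) → (∀ i j, 0 ≤ W i j) → (∀ i, 0 ≤ η i) → PinConnected W η →
    ∫⁻ u, ENNReal.ofReal (susyDensity W η u) = ENNReal.ofReal (√(2 * π)) ^ n := by
  intro n
  induction n with
  | zero =>
    intro W η _ _ _ _
    simp [susyDensity, susyEnergy, lintegral_unique, volume_pi, Measure.pi_empty_univ]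
  | succ n ih =>
    intro W η hs hW hη hc
    have hmeas : Measurable fun u : Fin (n + 1) → ℝ => ENNReal.ofReal (susyDensity W η u) :=
      (continuous_susyDensity continuous_const continuous_const continuous_id).measurable.ennreal_ofReal
    have e := (volume_preserving_piFinSuccAbove (fun _ : Fin (n + 1) => ℝ) 0).symm
    rw [← e.lintegral_comp_emb (MeasurableEquiv.measurableEmbedding _)]
    rw [Measure.volume_eq_prod, lintegral_prod_symm' _ (by exact hmeas.comp (MeasurableEquiv.measurable _))]
    have hcpos : ∀ u : Fin n → ℝ, 0 < (∑ j : Fin n, W 0 j.succ * exp (u j)) + η 0 :=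
      fun u => hc.sum_pos hW hη fun j => exp_pos (u j)
    have hspos : 0 < (∑ j : Fin n, W 0 j.succ) + η 0 := by
      simpa using hc.sum_pos hW hη (p := fun _ => 1) fun _ => one_pos
    have hcont : Continuous fun p : (Fin n → ℝ) × ℝ =>
        susyDensity (elimW W p.2) (elimEta W η p.2) p.1 := by
      refine continuous_susyDensity ?_ ?_ continuous_fst
      · unfold elimW; fun_prop
      · unfold elimEta; fun_prop
    calc ∫⁻ u : Fin n → ℝ, ∫⁻ u0 : ℝ, ENNReal.ofReal (susyDensity W η
          ((MeasurableEquiv.piFinSuccAbove (fun _ : Fin (n + 1) => ℝ) 0).symm (u0, u)))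
        = ∫⁻ u : Fin n → ℝ, ∫⁻ t : ℝ, ENNReal.ofReal (exp (-t / 2) *
            exp (-(exp (-t / 2) - ((∑ j : Fin n, W 0 j.succ) + η 0) * exp (t / 2)) ^ 2 / 2)) *
            ENNReal.ofReal (susyDensity (elimW W t) (elimEta W η t) u) := by
          refine lintegral_congr fun u => ?_
          rw [← lintegral_add_right_eq_self _ (log ((∑ j : Fin n, W 0 j.succ * exp (u j)) + η 0))]
          refine lintegral_congr fun t => ?_
          rw [← ENNReal.ofReal_mul (by positivity), ← susyDensity_cons hs u t (hcpos u)]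
          congr 2
          simp [MeasurableEquiv.piFinSuccAbove, Fin.consEquiv]
      _ = ∫⁻ t : ℝ, ∫⁻ u : Fin n → ℝ, ENNReal.ofReal (exp (-t / 2) *
            exp (-(exp (-t / 2) - ((∑ j : Fin n, W 0 j.succ) + η 0) * exp (t / 2)) ^ 2 / 2)) *
            ENNReal.ofReal (susyDensity (elimW W t) (elimEta W η t) u) := by
          refine lintegral_lintegral_swap (Measurable.aemeasurable ?_)
          exact Measurable.mul (by fun_prop) hcont.measurable.ennreal_ofReal
      _ = ∫⁻ t : ℝ, ENNReal.ofReal (exp (-t / 2) *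
            exp (-(exp (-t / 2) - ((∑ j : Fin n, W 0 j.succ) + η 0) * exp (t / 2)) ^ 2 / 2)) *
            ENNReal.ofReal (√(2 * π)) ^ n := by
          refine lintegral_congr fun t => ?_
          rw [lintegral_const_mul' _ _ ENNReal.ofReal_ne_top, ih]
          · intro i j
            rw [elimW, elimW, hs i.succ]
            ring
          · intro i j
            have h1 := hW i.succ j.succ
            have h2 := hW 0 i.succ
            have h3 := hW 0 j.succ
            unfold elimW
            positivity
          · intro i
            have h1 := hη i.succ
            have h2 := hW 0 i.succ
            have h3 := hη 0
            unfold elimEta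
            positivity
          · exact hc.elim hs hW hη t
      _ = ENNReal.ofReal (√(2 * π)) ^ (n + 1) := by
          rw [lintegral_mul_const' _ _ (ENNReal.pow_ne_top ENNReal.ofReal_ne_top),
            lintegral_inverseGaussian hspos, pow_succ']

/-- Normalization of the hyperbolic sigma model density on a finite index set. -/
theorem lintegral_susyDensity (W : ι → ι → ℝ) (η : ι → ℝ) (hs : ∀ i j, W i j = W j i)
    (hW : ∀ i j, 0 ≤ W i j) (hη : ∀ i, 0 ≤ η i) (hc : PinConnected W η) :
    ∫⁻ u, ENNReal.ofReal (susyDensity W η u) = ENNReal.ofReal (√(2 * π)) ^ Fintype.card ι := by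
  set σ := (Fintype.equivFin ι).symm with hσ
  rw [← lintegral_susyDensity_fin (Fintype.card ι) (fun i j => W (σ i) (σ j)) (fun i => η (σ i))
    (fun i j => hs _ _) (fun i j => hW _ _) (fun i => hη _) ?_]
  · rw [← (volume_measurePreserving_piCongrLeft (fun _ : ι => ℝ) σ).lintegral_comp_emb
      (MeasurableEquiv.measurableEmbedding _)]
    refine lintegral_congr fun u => ?_
    set v := (MeasurableEquiv.piCongrLeft (fun _ : ι => ℝ) σ) u with hv
    have hvu : ∀ i, v (σ i) = u i := fun i => Equiv.piCongrLeft_apply_apply (fun _ : ι => ℝ) σ u i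
    congr 1
    rw [susyDensity, susyDensity]
    congr 2
    · rw [susyEnergy, susyEnergy]
      simp only [← Equiv.sum_comp σ (fun i => ∑ j, W i j * (exp (v j - v i) - 1)),
        ← Equiv.sum_comp σ (fun i => η i * ((exp (v i) + exp (-v i)) / 2 - 1)), hvu]
      congr 4
      ext i
      rw [← Equiv.sum_comp σ]
      simp only [hvu]
    · rw [← Matrix.det_submatrix_equiv_self σ]
      congr 1
      ext i j
      simp only [susyMatrix, Matrix.submatrix_apply, hvu, σ.injective.eq_iff,
        ← Equiv.sum_comp σ (fun k => W (σ i) k * exp (v k - u i))]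
  · intro S hS
    obtain ⟨k, hk, hk'⟩ := hc (S.map σ.toEmbedding) (hS.map)
    obtain ⟨i, hi, rfl⟩ := Finset.mem_map.1 hk
    refine ⟨i, hi, hk'.imp_right ?_⟩
    rintro ⟨j, hj, hj'⟩
    refine ⟨σ.symm j, fun h => hj (Finset.mem_map.2 ⟨_, h, by simp⟩), ?_⟩
    simpa using hj'

end Susy

lemma lintegral_fin_prod : ∀ (n : ℕ) (f : Fin n → ℝ → ℝ≥0∞), (∀ i, Measurable (f i)) →
    ∫⁻ x : Fin n → ℝ, ∏ i, f i (x i) = ∏ i, ∫⁻ t, f i t := by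
  intro n
  induction n with
  | zero =>
    intro f _
    simp [lintegral_unique, volume_pi, Measure.pi_empty_univ]
  | succ n ih =>
    intro f hf
    have e := (volume_preserving_piFinSuccAbove (fun _ : Fin (n + 1) => ℝ) 0).symm
    rw [← e.lintegral_comp_emb (MeasurableEquiv.measurableEmbedding _), Fin.prod_univ_succ,
      ← ih _ (fun i => hf i.succ), Measure.volume_eq_prod,
      ← lintegral_prod_mul (hf 0).aemeasurable (Finset.measurable_prod _ fun i _ =>
        (hf i.succ).comp (measurable_pi_apply i)).aemeasurable]
    refine lintegral_congr fun p => ?_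
    rw [Fin.prod_univ_succ]
    simp [MeasurableEquiv.piFinSuccAbove, Fin.consEquiv]

/-- Tonelli for a product of functions of separate coordinates. -/
lemma lintegral_pi_prod {ι : Type*} [Fintype ι] (f : ι → ℝ → ℝ≥0∞) (hf : ∀ i, Measurable (f i)) :
    ∫⁻ x : ι → ℝ, ∏ i, f i (x i) = ∏ i, ∫⁻ t, f i t := by
  set σ := (Fintype.equivFin ι).symm
  rw [← Equiv.prod_comp σ (fun i => ∫⁻ t, f i t), ← lintegral_fin_prod _ _ (fun i => hf (σ i)),
    ← (volume_measurePreserving_piCongrLeft (fun _ : ι => ℝ) σ).lintegral_comp_emb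
      (MeasurableEquiv.measurableEmbedding _)]
  refine lintegral_congr fun u => ?_
  rw [← Equiv.prod_comp σ]
  refine Finset.prod_congr rfl fun i _ => ?_
  congr 1
  exact Equiv.piCongrLeft_apply_apply (fun _ : ι => ℝ) σ u i

/-- The Gamma integral in logarithmic coordinates. -/
lemma lintegral_exp_gamma {b c : ℝ} (hb : 0 < b) (hc : 0 < c) :
    ∫⁻ y : ℝ, ENNReal.ofReal (exp (b * y - c * exp y)) = ENNReal.ofReal (Gamma b * c ^ (-b)) := by
  have hsub := lintegral_image_eq_lintegral_abs_deriv_mul (f := exp) (f' := exp) MeasurableSet.univ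
    (fun t _ => (Real.hasDerivAt_exp t).hasDerivWithinAt) exp_injective.injOn
    (fun x => ENNReal.ofReal (x ^ (b - 1) * exp (-(c * x))))
  rw [Set.image_univ, range_exp, Measure.restrict_univ] at hsub
  have hint := integral_rpow_mul_exp_neg_mul_Ioi hb hc
  have hval : (1 / c) ^ b * Gamma b = Gamma b * c ^ (-b) := by
    rw [one_div, inv_rpow hc.le, rpow_neg hc.le, mul_comm]
  have hpos : 0 < Gamma b * c ^ (-b) := mul_pos (Gamma_pos_of_pos hb) (rpow_pos_of_pos hc _)
  rw [hval] at hint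
  have hi : Integrable (fun x => x ^ (b - 1) * exp (-(c * x))) (volume.restrict (Set.Ioi 0)) :=
    Integrable.of_integral_ne_zero (by rw [hint]; exact hpos.ne')
  rw [← hint, ofReal_integral_eq_lintegral_ofReal hi, hsub]
  · refine lintegral_congr fun y => ?_
    rw [← ENNReal.ofReal_mul (abs_nonneg _), abs_of_pos (exp_pos _), ← exp_mul, ← mul_assoc,
      ← exp_add, ← exp_add]
    congr 2
    ring
  · filter_upwards [ae_restrict_mem measurableSet_Ioi] with x hx
    exact mul_nonneg (rpow_nonneg (le_of_lt hx) _) (exp_pos _).le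

lemma lintegral_exp_neg_two_gamma {b c : ℝ} (hb : 0 < b) (hc : 0 < c) :
    ∫⁻ u : ℝ, ENNReal.ofReal (exp (-(2 * b) * u - c * exp (-2 * u))) =
      ENNReal.ofReal (Gamma b * c ^ (-b) / 2) := by
  have hsub := lintegral_image_eq_lintegral_abs_deriv_mul (f := fun u : ℝ => -2 * u)
    (f' := fun _ => -2) MeasurableSet.univ
    (fun t _ => ((hasDerivAt_id t).const_mul (-2)).hasDerivWithinAt.congr_deriv (by simp))
    (mul_right_injective₀ (by norm_num)).injOn
    (fun y => ENNReal.ofReal (exp (b * y - c * exp y)))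
  rw [Set.image_univ, (mul_left_surjective₀ (by norm_num : (-2 : ℝ) ≠ 0)).range_eq,
    Measure.restrict_univ, lintegral_exp_gamma hb hc, lintegral_const_mul _ (by fun_prop)] at hsub
  rw [ENNReal.ofReal_div_of_pos two_pos, hsub, abs_neg, abs_two, mul_comm (ENNReal.ofReal 2),
    ENNReal.mul_div_cancel_right (by simp) (by simp)]
  refine lintegral_congr fun u => ?_
  congr 3
  ring

/-- Change of variables `u = exp y` on the positive orthant. -/
lemma lintegral_orthant_eq {ι : Type*} [Fintype ι] (g : (ι → ℝ) → ℝ≥0∞) :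
    ∫⁻ u in {u : ι → ℝ | ∀ i, 0 < u i}, g u =
      ∫⁻ y : ι → ℝ, ENNReal.ofReal (∏ i, exp (y i)) * g (fun i => exp (y i)) := by
  set f' : (ι → ℝ) → (ι → ℝ) →L[ℝ] (ι → ℝ) := fun y =>
    ContinuousLinearMap.pi fun i => exp (y i) • ContinuousLinearMap.proj i with hf'
  have hsub := lintegral_image_eq_lintegral_abs_det_fderiv_mul (volume : Measure (ι → ℝ))
    (f := fun y i => exp (y i)) (f' := f') MeasurableSet.univ
    (fun y _ => (hasFDerivAt_pi.2 fun i =>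
      (hasFDerivAt_apply i y).exp).hasFDerivWithinAt)
    (fun y _ z _ h => funext fun i => exp_injective (congrFun h i)) g
  have himg : (fun (y : ι → ℝ) i => exp (y i)) '' Set.univ = {u : ι → ℝ | ∀ i, 0 < u i} := by
    ext u
    constructor
    · rintro ⟨y, _, rfl⟩ i
      exact exp_pos _
    · intro hu
      exact ⟨fun i => log (u i), trivial, funext fun i => exp_log (hu i)⟩
  rw [himg, Measure.restrict_univ] at hsub
  rw [hsub]
  refine lintegral_congr fun y => ?_
  have hdet : (f' y).det = ∏ i, exp (y i) := by
    rw [← Matrix.det_diagonal, ← LinearMap.det_toLin']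
    change LinearMap.det (f' y : (ι → ℝ) →ₗ[ℝ] (ι → ℝ)) = _
    congr 1
    ext v i
    simp [hf', Matrix.mulVec_diagonal]
  rw [hdet, abs_of_pos (Finset.prod_pos fun i _ => exp_pos _)]

lemma vw_eq_sum_incident (G : SimpleGraph V) [DecidableRel G.Adj] (F : Sym2 V → ℝ) (v : V) :
    vw G F v = ∑ e ∈ G.edgeFinset, if v ∈ e then F e else 0 := by
  rw [vw, ← Finset.sum_filter]
  refine Finset.sum_nbij (fun j => s(v, j)) ?_ ?_ ?_ fun _ _ => rfl
  · intro j hj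
    simpa using hj
  · intro i _ j _ h
    exact Sym2.congr_right.1 h
  · intro e he
    obtain ⟨he, hv⟩ := Finset.mem_filter.1 he
    obtain ⟨j, rfl⟩ := Sym2.mem_iff_exists.1 hv
    exact ⟨j, by simpa using he, rfl⟩

/-- Summation by parts between edges and vertices. -/
lemma sum_edge_mul_ssum (G : SimpleGraph V) [DecidableRel G.Adj] (F : Sym2 V → ℝ) (f : V → ℝ) :
    ∑ e ∈ G.edgeFinset, F e * ssum f e = ∑ v, vw G F v * f v := by
  simp only [vw_eq_sum_incident, Finset.sum_mul]
  rw [Finset.sum_comm]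
  refine Finset.sum_congr rfl fun e he => ?_
  induction e using Sym2.ind with
  | _ i j =>
    have hij : i ≠ j := by
      rw [SimpleGraph.mem_edgeFinset, SimpleGraph.mem_edgeSet] at he
      exact he.ne
    have : ∀ v, (if v ∈ s(i, j) then F s(i, j) else 0) * f v =
        if v ∈ ({i, j} : Finset V) then F s(i, j) * f v else 0 := by
      intro v
      simp only [Sym2.mem_iff, Finset.mem_insert, Finset.mem_singleton, ite_mul, zero_mul]
    rw [Finset.sum_congr rfl fun v _ => this v, Finset.sum_ite_mem, Finset.univ_inter,
      Finset.sum_pair hij]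
    simp only [ssum, Sym2.lift_mk]
    ring

lemma sum_vw (G : SimpleGraph V) [DecidableRel G.Adj] (F : Sym2 V → ℝ) :
    ∑ v, vw G F v = 2 * ∑ e ∈ G.edgeFinset, F e := by
  have h := sum_edge_mul_ssum G F (fun _ => 1)
  simp only [mul_one] at h
  rw [← h, Finset.mul_sum]
  refine Finset.sum_congr rfl fun e _ => ?_
  induction e using Sym2.ind with
  | _ i j => simp only [ssum, Sym2.lift_mk]; ring

lemma vw_eq_sum_univ (G : SimpleGraph V) [DecidableRel G.Adj] {w : Sym2 V → ℝ}
    (hw : ∀ e ∉ G.edgeFinset, w e = 0) (v : V) : vw G w v = ∑ j, w s(v, j) := by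
  refine Finset.sum_subset (Finset.subset_univ _) fun j _ hj => hw _ ?_
  simpa using hj

lemma vw_pos {G : SimpleGraph V} [DecidableRel G.Adj] (hG : G.Connected)
    {e0 : Sym2 V} (he0 : e0 ∈ G.edgeFinset) {w : Sym2 V → ℝ}
    (hw : ∀ e ∈ G.edgeFinset, 0 < w e) (v : V) : 0 < vw G w v := by
  have hnt : Nontrivial V := by
    induction e0 using Sym2.ind with
    | _ i j =>
      rw [SimpleGraph.mem_edgeFinset, SimpleGraph.mem_edgeSet] at he0
      exact ⟨i, j, he0.ne⟩
  obtain ⟨j, hj⟩ := hG.preconnected.exists_adj_of_nontrivial v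
  refine Finset.sum_pos (fun k hk => hw _ (by simpa using hk)) ⟨j, by simpa using hj⟩

/-- Extension of a function on the non-root vertices by `0` at the root. -/
def rootExt (x : V) (u : {v : V // v ≠ x} → ℝ) (v : V) : ℝ :=
  if h : v ≠ x then u ⟨v, h⟩ else 0

lemma rootExt_root (x : V) (u : {v : V // v ≠ x} → ℝ) : rootExt x u x = 0 := by simp [rootExt]

lemma rootExt_coe (x : V) (u : {v : V // v ≠ x} → ℝ) (i : {v : V // v ≠ x}) :
    rootExt x u i = u i := by simp [rootExt, i.2]

lemma sum_eq_root_add (x : V) (f : V → ℝ) :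
    ∑ v, f v = f x + ∑ i : {v : V // v ≠ x}, f i :=
  Fintype.sum_eq_add_sum_subtype_ne f x

lemma prod_eq_root_mul (x : V) (f : V → ℝ) :
    ∏ v, f v = f x * ∏ i : {v : V // v ≠ x}, f i :=
  Fintype.prod_eq_mul_prod_subtype_ne f x

/-- Edge weights `e^{y_e}` from logarithmic coordinates, vanishing off the edges. -/
def expW (G : SimpleGraph V) [DecidableRel G.Adj] (y : {e : Sym2 V // e ∈ G.edgeFinset} → ℝ)
    (e : Sym2 V) : ℝ :=
  if h : e ∈ G.edgeFinset then exp (y ⟨e, h⟩) else 0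

section

variable (G : SimpleGraph V) [DecidableRel G.Adj]

lemma expW_pos (y : {e : Sym2 V // e ∈ G.edgeFinset} → ℝ) {e : Sym2 V} (he : e ∈ G.edgeFinset) :
    0 < expW G y e := by
  rw [expW, dif_pos he]
  exact exp_pos _

lemma expW_nonneg (y : {e : Sym2 V // e ∈ G.edgeFinset} → ℝ) (e : Sym2 V) : 0 ≤ expW G y e := by
  rw [expW]
  split_ifs
  exacts [(exp_pos _).le, le_rfl]

lemma expW_of_notMem (y : {e : Sym2 V // e ∈ G.edgeFinset} → ℝ) {e : Sym2 V}
    (he : e ∉ G.edgeFinset) : expW G y e = 0 := by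
  rw [expW, dif_neg he]

lemma expW_add (y z : {e : Sym2 V // e ∈ G.edgeFinset} → ℝ) (f : V → ℝ)
    (hz : ∀ e, z e = ssum f e) (e : Sym2 V) :
    expW G (y + z) e = expW G y e * exp (ssum f e) := by
  rw [expW, expW]
  split_ifs with h
  · rw [Pi.add_apply, exp_add, hz]
  · simp

lemma sum_attach_edge (F : Sym2 V → ℝ) :
    ∑ e : {e : Sym2 V // e ∈ G.edgeFinset}, F e = ∑ e ∈ G.edgeFinset, F e :=
  Finset.sum_coe_sort _ F

variable (x : V) (u : {v : V // v ≠ x} → ℝ)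
  (y z : {e : Sym2 V // e ∈ G.edgeFinset} → ℝ)

lemma vw_expW_add (hz : ∀ e, z e = ssum (rootExt x u) e) (v : V) :
    vw G (expW G (y + z)) v =
    ∑ j, expW G y s(v, j) * exp (rootExt x u v + rootExt x u j) := by
  rw [vw_eq_sum_univ G fun e he => expW_of_notMem G _ he]
  refine Finset.sum_congr rfl fun j _ => ?_
  rw [expW_add G y z _ hz]
  rfl

lemma tau_expW_add (hz : ∀ e, z e = ssum (rootExt x u) e) :
    tau G (expW G (y + z)) = (susyMatrix (fun i j : {v : V // v ≠ x} => expW G y s((i : V), j))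
      (fun i => expW G y s((i : V), x)) u).det * (exp (∑ i, u i)) ^ 2 := by
  rw [tau_eq_det_reducedLaplacian G x]
  have hL : reducedLaplacian G x (expW G (y + z)) =
      Matrix.diagonal (fun i => exp (u i)) *
        susyMatrix (fun i j : {v : V // v ≠ x} => expW G y s((i : V), j))
          (fun i => expW G y s((i : V), x)) u * Matrix.diagonal (fun i => exp (u i)) := by
    ext i j
    rw [Matrix.mul_diagonal, Matrix.diagonal_mul]
    have hoff : (if G.Adj i j then expW G (y + z) s((i : V), (j : V)) else 0) =
        exp (u i) * expW G y s((i : V), j) * exp (u j) := by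
      split_ifs with h
      · rw [expW_add G y z _ hz]
        simp only [ssum, Sym2.lift_mk, rootExt_coe, exp_add]
        ring
      · rw [expW_of_notMem G y (by simpa using h)]
        ring
    rw [reducedLaplacian, hoff, susyMatrix]
    by_cases hij : i = j
    · subst hij
      rw [if_pos rfl, if_pos rfl, vw_expW_add G x u y z hz, sum_eq_root_add x, rootExt_coe,
        rootExt_root]
      have h1 : ∑ k : {v : V // v ≠ x}, expW G y s((i : V), k) *
          exp (u i + rootExt x u k) = exp (u i) * exp (u i) *
            ∑ k : {v : V // v ≠ x}, expW G y s((i : V), k) * exp (u k - u i) := by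
        rw [Finset.mul_sum]
        refine Finset.sum_congr rfl fun k _ => ?_
        rw [rootExt_coe, sub_eq_add_neg, exp_add, exp_add, exp_neg]
        field_simp
      rw [h1, add_zero, exp_neg]
      field_simp
      ring
    · rw [if_neg hij, if_neg hij]
      ring
  rw [hL, Matrix.det_mul, Matrix.det_mul, Matrix.det_diagonal, ← exp_sum]
  ring

lemma susyEnergy_expW (hz : ∀ e, z e = ssum (rootExt x u) e) :
    susyEnergy (fun i j : {v : V // v ≠ x} => expW G y s((i : V), j))
      (fun i => expW G y s((i : V), x)) u =
      (∑ v, vw G (expW G (y + z)) v * exp (-2 * rootExt x u v)) / 2 -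
        ∑ e ∈ G.edgeFinset, expW G y e := by
  have h1 : ∑ v, vw G (expW G (y + z)) v * exp (-2 * rootExt x u v) =
      ∑ v, ∑ j, expW G y s(v, j) * exp (rootExt x u j - rootExt x u v) := by
    refine Finset.sum_congr rfl fun v _ => ?_
    rw [vw_expW_add G x u y z hz, Finset.sum_mul]
    refine Finset.sum_congr rfl fun j _ => ?_
    rw [mul_assoc, ← exp_add]
    congr 2
    ring
  have h2 : ∑ e ∈ G.edgeFinset, expW G y e = (∑ v, ∑ j, expW G y s(v, j)) / 2 := by
    have := sum_vw G (expW G y)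
    simp only [vw_eq_sum_univ G fun e he => expW_of_notMem G y he] at this
    rw [this]
    ring
  have hxx : expW G y s(x, x) = 0 := expW_of_notMem G y (by simp)
  rw [h1, h2]
  simp only [sum_eq_root_add x, rootExt_root, rootExt_coe, hxx, zero_mul, Finset.sum_add_distrib]
  rw [susyEnergy]
  have h3 : ∀ i : {v : V // v ≠ x}, expW G y s(x, (i : V)) = expW G y s((i : V), x) :=
    fun i => by rw [Sym2.eq_swap]
  simp only [h3, mul_sub, mul_one, mul_add, mul_div_assoc', Finset.sum_sub_distrib, sub_zero,
    zero_sub, ← Finset.sum_div, Finset.sum_add_distrib]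
  ring

end

section

variable (G : SimpleGraph V) [DecidableRel G.Adj]

lemma two_mul_bwt (x : V) (B : Sym2 V → ℝ) (i : {v : V // v ≠ x}) :
    2 * bwt G x B i = vw G B i + 1 := by
  rw [bwt, if_neg i.2]
  ring

lemma continuous_expW (e : Sym2 V) : Continuous fun y => expW G y e := by
  unfold expW
  split_ifs
  · exact (continuous_apply _).rexp
  · exact continuous_const

lemma continuous_vw_expW (v : V) : Continuous fun y => vw G (expW G y) v :=
  continuous_finsetSum _ fun _ _ => continuous_expW G _

lemma continuous_tau_expW : Continuous fun y => tau G (expW G y) :=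
  continuous_finsetSum _ fun _ _ => continuous_finsetProd _ fun _ _ => continuous_expW G _

lemma pinConnected_expW {G : SimpleGraph V} [DecidableRel G.Adj] (hG : G.Connected) (x : V)
    (y : {e : Sym2 V // e ∈ G.edgeFinset} → ℝ) :
    PinConnected (fun i j : {v : V // v ≠ x} => expW G y s((i : V), j))
      (fun i => expW G y s((i : V), x)) := by
  rintro S ⟨i, hi⟩
  obtain ⟨p⟩ := hG.preconnected (i : V) x
  obtain ⟨d, -, ⟨h1, hd1⟩, hd2⟩ := p.exists_boundary_dart
    {v | ∃ h : v ≠ x, (⟨v, h⟩ : {v : V // v ≠ x}) ∈ S} ⟨i.2, hi⟩ (by simp)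
  refine ⟨⟨d.fst, h1⟩, hd1, ?_⟩
  have hpos : 0 < expW G y s(d.fst, d.snd) := expW_pos G y (by simpa using d.adj)
  by_cases hx : d.snd = x
  · left
    subst hx
    exact hpos
  · right
    exact ⟨⟨d.snd, hx⟩, fun h => hd2 ⟨hx, h⟩, hpos⟩

/-- Rescaling the edge weights by the vertex field turns the product of Gamma densities and the
supersymmetric density into a function whose dependence on the field factorizes. -/
lemma gamma_mul_susyDensity (x : V) (B : Sym2 V → ℝ) (u : {v : V // v ≠ x} → ℝ)
    (y z : {e : Sym2 V // e ∈ G.edgeFinset} → ℝ) (hz : ∀ e, z e = ssum (rootExt x u) e) :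
    (∏ e : {e : Sym2 V // e ∈ G.edgeFinset}, exp (B e * y e - 1 * exp (y e))) *
      susyDensity (fun i j : {v : V // v ≠ x} => expW G y s((i : V), j))
        (fun i => expW G y s((i : V), x)) u =
    (exp (∑ e : {e : Sym2 V // e ∈ G.edgeFinset}, B e * (y + z) e) * √(tau G (expW G (y + z))) *
      exp (-(vw G (expW G (y + z)) x / 2))) *
      ∏ i : {v : V // v ≠ x}, exp (-(2 * bwt G x B i) * u i -
        vw G (expW G (y + z)) i / 2 * exp (-2 * u i)) := by
  have hsB : ∑ e : {e : Sym2 V // e ∈ G.edgeFinset}, B e * (y + z) e =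
      (∑ e : {e : Sym2 V // e ∈ G.edgeFinset}, B e * y e) +
      ∑ i : {v : V // v ≠ x}, vw G B i * u i := by
    simp only [Pi.add_apply, mul_add, Finset.sum_add_distrib, hz]
    rw [sum_attach_edge G (fun e => B e * ssum (rootExt x u) e), sum_edge_mul_ssum,
      sum_eq_root_add x, rootExt_root]
    simp only [rootExt_coe, mul_zero, zero_add]
  have hE : ∑ e : {e : Sym2 V // e ∈ G.edgeFinset}, exp (y e) =
      ∑ e ∈ G.edgeFinset, expW G y e := by
    rw [← sum_attach_edge]
    exact Finset.sum_congr rfl fun e _ => by rw [expW, dif_pos e.2]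
  rw [susyDensity, susyEnergy_expW G x u y z hz, tau_expW_add G x u y z hz,
    Real.sqrt_mul' _ (sq_nonneg _), Real.sqrt_sq (exp_pos _).le, ← exp_sum, ← exp_sum, hsB,
    sum_eq_root_add x (fun v => vw G (expW G (y + z)) v * exp (-2 * rootExt x u v)),
    rootExt_root]
  simp only [rootExt_coe, two_mul_bwt, one_mul, Finset.sum_sub_distrib, hE]
  set D := √(susyMatrix (fun i j : {v : V // v ≠ x} => expW G y s((i : V), j))
      (fun i => expW G y s((i : V), x)) u).det
  have key : ∀ {a b c d e f : ℝ}, a + b = c + d + e + f → exp a * (exp b * D) =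
      exp c * (D * exp d) * exp e * exp f := by
    intro a b c d e f h
    rw [show exp a * (exp b * D) = exp (a + b) * D by rw [exp_add]; ring, h, exp_add, exp_add,
      exp_add]
    ring
  refine key ?_
  have h1 : ∑ i : {v : V // v ≠ x}, -(vw G B i + 1) * u i =
      -(∑ i : {v : V // v ≠ x}, vw G B i * u i) - ∑ i, u i := by
    rw [← Finset.sum_neg_distrib, ← Finset.sum_sub_distrib]
    exact Finset.sum_congr rfl fun i _ => by ring
  have h2 : ∑ i : {v : V // v ≠ x}, vw G (expW G (y + z)) i / 2 * exp (-2 * u i) =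
      (∑ i : {v : V // v ≠ x}, vw G (expW G (y + z)) i * exp (-2 * u i)) / 2 := by
    rw [Finset.sum_div]
    exact Finset.sum_congr rfl fun i _ => by ring
  rw [h1, h2]
  simp only [mul_zero, exp_zero]
  ring

end

lemma bwt_pos {G : SimpleGraph V} [DecidableRel G.Adj] (hG : G.Connected)
    {e0 : Sym2 V} (he0 : e0 ∈ G.edgeFinset) {B : Sym2 V → ℝ}
    (hB : ∀ e ∈ G.edgeFinset, 0 < B e) (x v : V) : 0 < bwt G x B v := by
  have := vw_pos hG he0 hB v
  rw [bwt]
  split_ifs <;> linarith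

lemma ofReal_mul_prod {ι : Type*} [Fintype ι] {a : ℝ} (ha : 0 ≤ a) {f : ι → ℝ}
    (hf : ∀ i, 0 ≤ f i) :
    ENNReal.ofReal (a * ∏ i, f i) = ENNReal.ofReal a * ∏ i, ENNReal.ofReal (f i) := by
  rw [ENNReal.ofReal_mul ha, ENNReal.ofReal_prod_of_nonneg fun i _ => hf i]

/-- Total mass of the magic-formula weight before gauge fixing. -/
lemma lintegral_log_weights {G : SimpleGraph V} [DecidableRel G.Adj] (hG : G.Connected)
    {e0 : Sym2 V} (he0 : e0 ∈ G.edgeFinset) {B : Sym2 V → ℝ}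
    (hB : ∀ e ∈ G.edgeFinset, 0 < B e) (x : V) :
    ∫⁻ y : {e : Sym2 V // e ∈ G.edgeFinset} → ℝ, ENNReal.ofReal
      ((exp (∑ e : {e : Sym2 V // e ∈ G.edgeFinset}, B e * y e) * √(tau G (expW G y)) *
        exp (-(vw G (expW G y) x / 2))) *
        ∏ i : {v : V // v ≠ x},
          (Gamma (bwt G x B i) * (vw G (expW G y) i / 2) ^ (-bwt G x B i) / 2)) =
    ENNReal.ofReal ((∏ e ∈ G.edgeFinset, Gamma (B e)) *
      √(2 * π) ^ Fintype.card {v : V // v ≠ x}) := by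
  set P : ({e : Sym2 V // e ∈ G.edgeFinset} → ℝ) → ({v : V // v ≠ x} → ℝ) → ℝ := fun y u =>
    (exp (∑ e : {e : Sym2 V // e ∈ G.edgeFinset}, B e * y e) * √(tau G (expW G y)) *
      exp (-(vw G (expW G y) x / 2))) *
      ∏ i : {v : V // v ≠ x}, exp (-(2 * bwt G x B i) * u i -
        vw G (expW G y) i / 2 * exp (-2 * u i)) with hP
  have hw : ∀ y v, 0 < vw G (expW G y) v := fun y v =>
    vw_pos hG he0 (fun e he => expW_pos G y he) v
  have hb := bwt_pos hG he0 hB x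
  have hcw := continuous_vw_expW G
  have hct := continuous_tau_expW G
  have hce := continuous_expW G
  have hPm : Measurable (Function.uncurry fun y u => ENNReal.ofReal (P y u)) := by
    refine ENNReal.measurable_ofReal.comp (Continuous.measurable ?_)
    have h1 : ∀ v, Continuous fun p : ({e : Sym2 V // e ∈ G.edgeFinset} → ℝ) ×
        ({v : V // v ≠ x} → ℝ) => vw G (expW G p.1) v := fun v => (hcw v).comp continuous_fst
    have h2 : Continuous fun p : ({e : Sym2 V // e ∈ G.edgeFinset} → ℝ) ×
        ({v : V // v ≠ x} → ℝ) => tau G (expW G p.1) := hct.comp continuous_fst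
    simp only [hP]
    fun_prop
  set z : ({v : V // v ≠ x} → ℝ) → {e : Sym2 V // e ∈ G.edgeFinset} → ℝ :=
    fun u e => ssum (rootExt x u) e with hz
  have hcz : Continuous z := by
    refine continuous_pi fun ⟨e, _⟩ => ?_
    induction e using Sym2.ind with
    | _ i j =>
      have : ∀ v, Continuous fun u => rootExt x u v := by
        intro v
        unfold rootExt
        split_ifs
        · exact continuous_apply _
        · exact continuous_const
      exact (this i).add (this j)
  have hsusy : ∀ y, ∫⁻ u, ENNReal.ofReal (P (y + z u) u) =
      (∏ e : {e : Sym2 V // e ∈ G.edgeFinset},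
        ENNReal.ofReal (exp (B e * y e - 1 * exp (y e)))) *
        ENNReal.ofReal (√(2 * π)) ^ Fintype.card {v : V // v ≠ x} := by
    intro y
    rw [← lintegral_susyDensity _ _ (fun i j => by rw [Sym2.eq_swap])
      (fun i j => expW_nonneg G y _) (fun i => expW_nonneg G y _) (pinConnected_expW hG x y),
      ← lintegral_const_mul']
    · refine lintegral_congr fun u => ?_
      rw [← ENNReal.ofReal_prod_of_nonneg fun i _ => (exp_pos _).le,
        ← ENNReal.ofReal_mul (Finset.prod_nonneg fun i _ => (exp_pos _).le),
        gamma_mul_susyDensity G x B u y (z u) fun e => rfl]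
    · exact ENNReal.prod_ne_top fun _ _ => ENNReal.ofReal_ne_top
  have hgauss : ∀ y, ∫⁻ u, ENNReal.ofReal (P y u) = ENNReal.ofReal
      ((exp (∑ e : {e : Sym2 V // e ∈ G.edgeFinset}, B e * y e) * √(tau G (expW G y)) *
        exp (-(vw G (expW G y) x / 2))) *
        ∏ i : {v : V // v ≠ x},
          (Gamma (bwt G x B i) * (vw G (expW G y) i / 2) ^ (-bwt G x B i) / 2)) := by
    intro y
    simp only [hP]
    have hg : ∀ i : {v : V // v ≠ x},
        0 ≤ Gamma (bwt G x B i) * (vw G (expW G y) i / 2) ^ (-bwt G x B i) / 2 := fun i =>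
      div_nonneg (mul_nonneg (Gamma_pos_of_pos (hb i)).le
        (rpow_nonneg (half_pos (hw y i)).le _)) two_pos.le
    rw [ofReal_mul_prod (mul_nonneg (mul_nonneg (exp_pos _).le (sqrt_nonneg _))
      (exp_pos _).le) hg]
    simp only [ofReal_mul_prod (mul_nonneg (mul_nonneg (exp_pos _).le (sqrt_nonneg _))
      (exp_pos _).le) fun i => (exp_pos _).le]
    rw [lintegral_const_mul' _ _ ENNReal.ofReal_ne_top,
      lintegral_pi_prod (fun (i : {v : V // v ≠ x}) t => ENNReal.ofReal (exp (-(2 * bwt G x B i) *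
        t - vw G (expW G y) i / 2 * exp (-2 * t)))) fun i => by fun_prop]
    simp only [lintegral_exp_neg_two_gamma (hb _) (half_pos (hw y _))]
  have hPz : AEMeasurable (Function.uncurry fun u y => ENNReal.ofReal (P (y + z u) u))
      ((volume : Measure ({v : V // v ≠ x} → ℝ)).prod
        (volume : Measure ({e : Sym2 V // e ∈ G.edgeFinset} → ℝ))) :=
    (hPm.comp (((continuous_snd.add (hcz.comp continuous_fst)).prodMk
      continuous_fst).measurable)).aemeasurable
  simp only [← hgauss]
  rw [lintegral_lintegral_swap hPm.aemeasurable]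
  calc ∫⁻ u, ∫⁻ y, ENNReal.ofReal (P y u) = ∫⁻ u, ∫⁻ y, ENNReal.ofReal (P (y + z u) u) :=
        lintegral_congr fun u =>
          (lintegral_add_right_eq_self (fun y => ENNReal.ofReal (P y u)) (z u)).symm
    _ = ∫⁻ y, ∫⁻ u, ENNReal.ofReal (P (y + z u) u) := lintegral_lintegral_swap hPz
    _ = _ := by
        simp only [hsusy]
        rw [lintegral_mul_const' _ _ (by finiteness),
          lintegral_pi_prod (fun (e : {e : Sym2 V // e ∈ G.edgeFinset}) t =>
            ENNReal.ofReal (exp (B e * t - 1 * exp t))) fun i => by fun_prop,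
          ENNReal.ofReal_mul (Finset.prod_nonneg fun e he => (Gamma_pos_of_pos (hB e he)).le),
          ENNReal.ofReal_pow (sqrt_nonneg _)]
        congr 1
        rw [ENNReal.ofReal_prod_of_nonneg fun e he => (Gamma_pos_of_pos (hB e he)).le,
          ← Finset.prod_coe_sort G.edgeFinset]
        refine Finset.prod_congr rfl fun e _ => ?_
        rw [lintegral_exp_gamma (hB e e.2) one_pos, one_rpow, mul_one]

/-- Splitting off one coordinate and using it as the common scale of the remaining ones. -/
lemma lintegral_option_shear {ι κ : Type*} [Fintype ι] [Fintype κ] (σ : Option ι ≃ κ)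
    {g : (κ → ℝ) → ℝ≥0∞} (hg : Measurable g) :
    ∫⁻ y, g y = ∫⁻ z : ι → ℝ, ∫⁻ ρ : ℝ, g fun k => (σ.symm k).elim ρ fun i => z i + ρ := by
  have hcont : ∀ s : ℝ → ℝ, Measurable s → Measurable fun p : (ι → ℝ) × ℝ =>
      (fun k => (σ.symm k).elim p.2 fun i => p.1 i + s p.2 : κ → ℝ) := by
    intro s hs
    refine measurable_pi_lambda _ fun k => ?_
    cases σ.symm k with
    | none => exact measurable_snd
    | some i => exact ((measurable_pi_apply i).comp measurable_fst).add (hs.comp measurable_snd)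
  have hopt : MeasurePreserving (MeasurableEquiv.piOptionEquivProd fun _ : Option ι => ℝ).symm
      (volume : Measure ((ι → ℝ) × ℝ)) volume :=
    ⟨MeasurableEquiv.measurable _,
      Measure.pi_map_piOptionEquivProd fun _ : Option ι => (volume : Measure ℝ)⟩
  have h0 : ∫⁻ y, g y = ∫⁻ p : (ι → ℝ) × ℝ, g fun k => (σ.symm k).elim p.2 fun i => p.1 i + 0 := by
    rw [← (volume_measurePreserving_piCongrLeft (fun _ : κ => ℝ) σ).lintegral_comp_emb
      (MeasurableEquiv.measurableEmbedding _), ← hopt.lintegral_comp_emb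
      (MeasurableEquiv.measurableEmbedding _)]
    refine lintegral_congr fun p => congrArg g (funext fun k => ?_)
    obtain ⟨o, rfl⟩ := σ.surjective k
    rw [Equiv.symm_apply_apply]
    refine (Equiv.piCongrLeft_apply_apply (fun _ : κ => ℝ) σ _ o).trans ?_
    cases o with
    | none => rfl
    | some i => exact (add_zero (p.1 i)).symm
  rw [h0, Measure.volume_eq_prod, lintegral_prod_symm' (fun p : (ι → ℝ) × ℝ =>
      g fun k => (σ.symm k).elim p.2 fun i => p.1 i + 0) (hg.comp (hcont _ measurable_const)),
    lintegral_lintegral_swap (f := fun (z : ι → ℝ) (ρ : ℝ) =>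
      g fun k => (σ.symm k).elim ρ fun i => z i + ρ)
      (hg.comp (hcont id measurable_id)).aemeasurable]
  refine lintegral_congr fun ρ => ?_
  rw [← lintegral_add_right_eq_self (fun z : ι → ℝ =>
    g fun k => (σ.symm k).elim ρ fun i => z i + 0) (fun _ => ρ)]
  simp only [Pi.add_apply, add_zero]

section

variable (G : SimpleGraph V) [DecidableRel G.Adj]

/-- The edges of `G` as the reference edge together with the remaining ones. -/
def edgeOptionEquiv {G : SimpleGraph V} [DecidableRel G.Adj] {e0 : Sym2 V}
    (he0 : e0 ∈ G.edgeFinset) : Option (Epin G e0) ≃ {e : Sym2 V // e ∈ G.edgeFinset} where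
  toFun o := o.elim ⟨e0, he0⟩ fun i => ⟨i, i.2.1⟩
  invFun e := if h : e.1 = e0 then none else some ⟨e, e.2, h⟩
  left_inv o := by
    cases o with
    | none => simp
    | some i => simp [i.2.2]
  right_inv e := by
    by_cases h : e.1 = e0
    · simp [← h]
    · simp [h]

lemma vw_const_mul (c : ℝ) (w : Sym2 V → ℝ) (v : V) :
    vw G (fun e => c * w e) v = c * vw G w v := by
  rw [vw, vw, Finset.mul_sum]

lemma tau_const_mul (x : V) (c : ℝ) (w : Sym2 V → ℝ) :
    tau G (fun e => c * w e) = c ^ Fintype.card {v : V // v ≠ x} * tau G w := by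
  rw [tau_eq_det_reducedLaplacian G x, tau_eq_det_reducedLaplacian G x, ← Matrix.det_smul]
  congr 1
  ext i j
  rw [Matrix.smul_apply, reducedLaplacian, reducedLaplacian, vw_const_mul, smul_eq_mul, mul_sub]
  split_ifs <;> ring

lemma pinExt_pos {e0 : Sym2 V} {u : Epin G e0 → ℝ} (hu : ∀ i, 0 < u i) :
    ∀ e ∈ G.edgeFinset, 0 < pinExt G e0 u e := by
  intro e he
  rw [pinExt]
  split_ifs with h1 h2
  · exact one_pos
  · exact hu _
  · exact absurd ⟨he, h1⟩ h2

lemma sum_bwt (x : V) (B : Sym2 V → ℝ) :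
    ∑ v, bwt G x B v = ∑ e ∈ G.edgeFinset, B e + (Fintype.card {v : V // v ≠ x} : ℝ) / 2 := by
  have h := sum_vw G B
  rw [sum_eq_root_add x] at h ⊢
  have h1 : ∑ i : {v : V // v ≠ x}, bwt G x B i =
      (∑ i : {v : V // v ≠ x}, vw G B i) / 2 + (Fintype.card {v : V // v ≠ x} : ℝ) / 2 := by
    rw [← add_div, eq_div_iff two_ne_zero, mul_comm, Finset.mul_sum]
    simp [two_mul_bwt, Finset.sum_add_distrib]
  rw [h1, bwt, if_pos rfl]
  linarith

variable {G}

lemma expW_shear {e0 : Sym2 V} (he0 : e0 ∈ G.edgeFinset) (z : Epin G e0 → ℝ) (ρ : ℝ) :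
    expW G (fun k => ((edgeOptionEquiv he0).symm k).elim ρ fun i => z i + ρ) =
      fun e => exp ρ * pinExt G e0 (fun i => exp (z i)) e := by
  funext e
  rw [expW, pinExt]
  by_cases he : e ∈ G.edgeFinset
  · rw [dif_pos he]
    by_cases h : e = e0
    · simp [edgeOptionEquiv, h]
    · rw [if_neg h, dif_pos ⟨he, h⟩]
      simp [edgeOptionEquiv, h, exp_add, mul_comm]
  · rw [dif_neg he, if_neg (by rintro rfl; exact he he0), dif_neg fun h => he h.1, mul_zero]

lemma sum_shear {e0 : Sym2 V} (he0 : e0 ∈ G.edgeFinset) (B : Sym2 V → ℝ) (z : Epin G e0 → ℝ)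
    (ρ : ℝ) :
    ∑ e : {e : Sym2 V // e ∈ G.edgeFinset},
      B e * ((edgeOptionEquiv he0).symm e).elim ρ (fun i => z i + ρ) =
    (∑ e ∈ G.edgeFinset, B e) * ρ + ∑ i : Epin G e0, B i * z i := by
  rw [← sum_attach_edge, ← Equiv.sum_comp (edgeOptionEquiv he0),
    ← Equiv.sum_comp (edgeOptionEquiv he0) fun e => B e, Fintype.sum_option, Fintype.sum_option]
  simp only [Equiv.symm_apply_apply, Option.elim_none, Option.elim_some, mul_add,
    Finset.sum_add_distrib, add_mul, Finset.sum_mul]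
  simp only [edgeOptionEquiv, Equiv.coe_fn_mk, Option.elim_none, Option.elim_some]
  ring

lemma log_weight_shear (hG : G.Connected) {e0 : Sym2 V} (he0 : e0 ∈ G.edgeFinset)
    (B : Sym2 V → ℝ) (x : V) (z : Epin G e0 → ℝ) (ρ : ℝ)
    {w : Sym2 V → ℝ} (hw : w = pinExt G e0 (fun i => exp (z i)))
    {y : {e : Sym2 V // e ∈ G.edgeFinset} → ℝ}
    (hy : y = fun k => ((edgeOptionEquiv he0).symm k).elim ρ fun i => z i + ρ) :
    (exp (∑ e : {e : Sym2 V // e ∈ G.edgeFinset}, B e * y e) * √(tau G (expW G y)) *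
      exp (-(vw G (expW G y) x / 2))) *
      ∏ i : {v : V // v ≠ x},
        (Gamma (bwt G x B i) * (vw G (expW G y) i / 2) ^ (-bwt G x B i) / 2) =
    ((exp (∑ i : Epin G e0, B i * z i) * √(tau G w)) * ∏ i : {v : V // v ≠ x},
      (Gamma (bwt G x B i) * (vw G w i / 2) ^ (-bwt G x B i) / 2)) *
      exp (bwt G x B x * ρ - vw G w x / 2 * exp ρ) := by
  have hwp : ∀ v, 0 < vw G w v := fun v => vw_pos hG he0
    (hw ▸ pinExt_pos G fun i => exp_pos _) v
  have hsum := sum_bwt G x B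
  rw [sum_eq_root_add x] at hsum
  have hsq : √(exp ρ ^ Fintype.card {v : V // v ≠ x}) =
      exp ((Fintype.card {v : V // v ≠ x} : ℝ) / 2 * ρ) := by
    rw [← exp_nat_mul, ← exp_half]
    congr 1
    ring
  have hprod : ∀ i : {v : V // v ≠ x},
      Gamma (bwt G x B i) * (exp ρ * vw G w i / 2) ^ (-bwt G x B i) / 2 =
      exp (-bwt G x B i * ρ) * (Gamma (bwt G x B i) * (vw G w i / 2) ^ (-bwt G x B i) / 2) := by
    intro i
    rw [mul_div_assoc (exp ρ), mul_rpow (exp_pos _).le (half_pos (hwp i)).le, ← exp_mul, mul_comm ρ]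
    ring
  have hS : ∑ e : {e : Sym2 V // e ∈ G.edgeFinset}, B e * y e =
      (∑ e ∈ G.edgeFinset, B e) * ρ + ∑ i : Epin G e0, B i * z i := by
    rw [hy, sum_shear he0]
  rw [hS, hy, expW_shear he0, ← hw, tau_const_mul G x, sqrt_mul (by positivity), hsq]
  simp only [vw_const_mul, hprod, Finset.prod_mul_distrib, ← exp_sum, ← Finset.sum_mul,
    Finset.sum_neg_distrib]
  have hx : bwt G x B x * ρ - vw G w x / 2 * exp ρ = (∑ e ∈ G.edgeFinset, B e) * ρ +
      (Fintype.card {v : V // v ≠ x} : ℝ) / 2 * ρ + (-(exp ρ * vw G w x / 2)) +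
      (-∑ i : {v : V // v ≠ x}, bwt G x B i) * ρ := by
    linear_combination ρ * hsum
  rw [hx, exp_add, exp_add, exp_add, exp_add]
  ring

/-- Total mass of the magic-formula weight in logarithmic pinned coordinates. -/
lemma lintegral_pinned_log_weights (hG : G.Connected) {e0 : Sym2 V} (he0 : e0 ∈ G.edgeFinset)
    {B : Sym2 V → ℝ} (hB : ∀ e ∈ G.edgeFinset, 0 < B e) (x : V) :
    ∫⁻ z : Epin G e0 → ℝ, ENNReal.ofReal (exp (∑ i : Epin G e0, B i * z i) *
      √(tau G (pinExt G e0 fun i => exp (z i))) * (∏ v, (Gamma (bwt G x B v) *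
        (vw G (pinExt G e0 fun i => exp (z i)) v / 2) ^ (-bwt G x B v))) *
        (1 / 2) ^ Fintype.card {v : V // v ≠ x}) =
    ENNReal.ofReal ((∏ e ∈ G.edgeFinset, Gamma (B e)) *
      √(2 * π) ^ Fintype.card {v : V // v ≠ x}) := by
  have hb := bwt_pos hG he0 hB x
  rw [← lintegral_log_weights hG he0 hB x, lintegral_option_shear (edgeOptionEquiv he0)]
  · refine lintegral_congr fun z => ?_
    set w := pinExt G e0 fun i => exp (z i) with hw
    have hwp : ∀ v, 0 < vw G w v := fun v => vw_pos hG he0 (pinExt_pos G fun i => exp_pos _) v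
    have hK : 0 ≤ (exp (∑ i : Epin G e0, B i * z i) * √(tau G w)) * ∏ i : {v : V // v ≠ x},
        (Gamma (bwt G x B i) * (vw G w i / 2) ^ (-bwt G x B i) / 2) :=
      mul_nonneg (mul_nonneg (exp_pos _).le (sqrt_nonneg _)) (Finset.prod_nonneg fun i _ =>
        div_nonneg (mul_nonneg (Gamma_pos_of_pos (hb i)).le
          (rpow_nonneg (half_pos (hwp i)).le _)) two_pos.le)
    simp only [log_weight_shear hG he0 B x z _ hw rfl, ENNReal.ofReal_mul hK]
    rw [lintegral_const_mul' _ _ ENNReal.ofReal_ne_top,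
      lintegral_exp_gamma (hb x) (half_pos (hwp x)), ← ENNReal.ofReal_mul hK, prod_eq_root_mul x]
    congr 1
    simp only [Finset.prod_div_distrib, Finset.prod_const, Finset.card_univ, div_pow, one_pow]
    ring
  · have hcw := continuous_vw_expW G
    have hct := continuous_tau_expW G
    have : ∀ i : {v : V // v ≠ x}, Measurable fun y => vw G (expW G y) i := fun i =>
      (hcw i).measurable
    have h2 := (hct.sqrt).measurable
    have h3 := (hcw x).measurable
    fun_prop
end

section

variable (G : SimpleGraph V) [DecidableRel G.Adj]

lemma magicDensity_eq (x : V) (B : Sym2 V → ℝ) {w : Sym2 V → ℝ} (hw : ∀ v, 0 < vw G w v) :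
    magicDensity G x B w = (Znorm G x B)⁻¹ * ((∏ e ∈ G.edgeFinset, w e ^ (B e - 1)) *
      (∏ v, vw G w v ^ (-bwt G x B v)) * √(tau G w)) := by
  have h : ∏ v, vw G w v ^ (-bwt G x B v) =
      vw G w x ^ ((1 : ℝ) / 2) * (∏ v, vw G w v ^ ((vw G B v + 1) / 2))⁻¹ := by
    rw [prod_eq_root_mul x, prod_eq_root_mul x fun v => vw G w v ^ ((vw G B v + 1) / 2),
      mul_inv, ← Finset.prod_inv_distrib, ← mul_assoc, ← rpow_neg (hw x).le, ← rpow_add (hw x)]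
    congr 1
    · congr 1
      rw [bwt, if_pos rfl]
      ring
    · refine Finset.prod_congr rfl fun i _ => ?_
      rw [← rpow_neg (hw i).le, bwt, if_neg i.2, sub_zero]
  rw [magicDensity, h]
  ring

variable {G} {e0 : Sym2 V}

lemma pinExt_pos_iff (u : Epin G e0 → ℝ) :
    (∀ e ∈ G.edgeFinset, 0 < pinExt G e0 u e) ↔ ∀ i, 0 < u i := by
  refine ⟨fun h i => ?_, pinExt_pos G⟩
  have := h i i.2.1
  rwa [pinExt, if_neg i.2.2, dif_pos i.2] at this

lemma prod_exp_mul_prod_rpow (he0 : e0 ∈ G.edgeFinset) (B : Sym2 V → ℝ) (z : Epin G e0 → ℝ) :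
    (∏ i, exp (z i)) *
      ∏ e ∈ G.edgeFinset, pinExt G e0 (fun i => exp (z i)) e ^ (B e - 1) =
    exp (∑ i : Epin G e0, B i * z i) := by
  rw [← Finset.prod_coe_sort G.edgeFinset, ← Equiv.prod_comp (edgeOptionEquiv he0),
    Fintype.prod_option, exp_sum]
  have h0 : pinExt G e0 (fun i => exp (z i)) (edgeOptionEquiv he0 none) = 1 := by
    simp [edgeOptionEquiv, pinExt]
  rw [h0, one_rpow, one_mul, ← Finset.prod_mul_distrib]
  refine Finset.prod_congr rfl fun i _ => ?_
  have hi : pinExt G e0 (fun i => exp (z i)) (edgeOptionEquiv he0 (some i)) = exp (z i) := by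
    simp [edgeOptionEquiv, pinExt, i.2.2, (SimpleGraph.mem_edgeFinset.1 i.2.1)]
  rw [hi, ← exp_mul, ← exp_add]
  change exp (z i + z i * (B i - 1)) = _
  ring_nf

lemma Znorm_pos (hG : G.Connected) (he0 : e0 ∈ G.edgeFinset)
    {B : Sym2 V → ℝ} (hB : ∀ e ∈ G.edgeFinset, 0 < B e) (x : V) : 0 < Znorm G x B := by
  have h1 : 0 < ∏ e ∈ G.edgeFinset, Gamma (B e) :=
    Finset.prod_pos fun e he => Gamma_pos_of_pos (hB e he)
  have h2 : 0 < ∏ v, Gamma (bwt G x B v) :=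
    Finset.prod_pos fun v _ => Gamma_pos_of_pos (bwt_pos hG he0 hB x v)
  rw [Znorm]
  positivity

lemma Znorm_mul (hG : G.Connected) (he0 : e0 ∈ G.edgeFinset)
    {B : Sym2 V → ℝ} (hB : ∀ e ∈ G.edgeFinset, 0 < B e) (x : V) :
    Znorm G x B * ((∏ v, Gamma (bwt G x B v)) * 2 ^ (∑ v, bwt G x B v) *
      (1 / 2) ^ Fintype.card {v : V // v ≠ x}) =
    (∏ e ∈ G.edgeFinset, Gamma (B e)) * √(2 * π) ^ Fintype.card {v : V // v ≠ x} := by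
  have h2 : 0 < ∏ v, Gamma (bwt G x B v) :=
    Finset.prod_pos fun v _ => Gamma_pos_of_pos (bwt_pos hG he0 hB x v)
  have hn : (Fintype.card V : ℝ) = 1 + Fintype.card {v : V // v ≠ x} := by
    have := sum_eq_root_add x (fun _ : V => (1 : ℝ))
    simpa using this
  rw [Znorm, sum_bwt, hn]
  set n := Fintype.card {v : V // v ≠ x}
  have hs : √(2 * π) ^ n = 2 ^ ((n : ℝ) / 2) * π ^ ((n : ℝ) / 2) := by
    rw [sqrt_eq_rpow, ← rpow_natCast, ← rpow_mul (by positivity), mul_rpow two_pos.le pi_pos.le]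
    ring_nf
  have hh : ((1 : ℝ) / 2) ^ n = 2 ^ (-(n : ℝ)) := by
    rw [rpow_neg two_pos.le, rpow_natCast, one_div, inv_pow]
  have he : (2 : ℝ) ^ (∑ e ∈ G.edgeFinset, B e + (n : ℝ) / 2) * 2 ^ (-(n : ℝ)) =
      2 ^ ((n : ℝ) / 2) * 2 ^ (1 - (1 + (n : ℝ)) + ∑ e ∈ G.edgeFinset, B e) := by
    rw [← rpow_add two_pos, ← rpow_add two_pos]
    congr 1
    ring
  rw [hs, hh, mul_assoc (∏ v, Gamma _), he, show (1 + (n : ℝ) - 1) / 2 = n / 2 by ring]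
  have h3 : (0 : ℝ) < 2 ^ (1 - (1 + (n : ℝ)) + ∑ e ∈ G.edgeFinset, B e) := by positivity
  field_simp

lemma lintegral_pos_eq_setLIntegral (f : (Epin G e0 → ℝ) → ℝ) :
    ∫⁻ u : Epin G e0 → ℝ, ENNReal.ofReal
      (if ∀ e ∈ G.edgeFinset, 0 < pinExt G e0 u e then f u else 0) =
    ∫⁻ u in {u : Epin G e0 → ℝ | ∀ i, 0 < u i}, ENNReal.ofReal (f u) := by
  rw [← lintegral_indicator]
  · refine lintegral_congr fun u => ?_
    simp only [pinExt_pos_iff, Set.indicator, Set.mem_ofPred_eq]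
    split_ifs <;> simp
  · rw [Set.ofPred_forall]
    exact MeasurableSet.iInter fun i => measurableSet_lt measurable_const (measurable_pi_apply i)

/-- The magic formula: the density integrates to one. -/
lemma lintegral_magicDensity (hG : G.Connected) (he0 : e0 ∈ G.edgeFinset)
    {B : Sym2 V → ℝ} (hB : ∀ e ∈ G.edgeFinset, 0 < B e) (x : V) :
    ∫⁻ u : Epin G e0 → ℝ, ENNReal.ofReal
      (if ∀ e ∈ G.edgeFinset, 0 < pinExt G e0 u e then
        magicDensity G x B (pinExt G e0 u) else 0) = 1 := by
  have hZ := Znorm_pos hG he0 hB x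
  have hZC := Znorm_mul hG he0 hB x
  have hM := lintegral_pinned_log_weights hG he0 hB x
  set n := Fintype.card {v : V // v ≠ x}
  set C : ℝ := (∏ v, Gamma (bwt G x B v)) * 2 ^ (∑ v, bwt G x B v) * (1 / 2) ^ n with hCdef
  have hC : 0 < C := by
    have h2 : 0 < ∏ v, Gamma (bwt G x B v) :=
      Finset.prod_pos fun v _ => Gamma_pos_of_pos (bwt_pos hG he0 hB x v)
    positivity
  rw [lintegral_pos_eq_setLIntegral, lintegral_orthant_eq]
  have hpt : ∀ z : Epin G e0 → ℝ, ENNReal.ofReal (∏ i, exp (z i)) *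
      ENNReal.ofReal (magicDensity G x B (pinExt G e0 fun i => exp (z i))) =
      ENNReal.ofReal (Znorm G x B * C)⁻¹ *
      ENNReal.ofReal (exp (∑ i : Epin G e0, B i * z i) *
      √(tau G (pinExt G e0 fun i => exp (z i))) * (∏ v, (Gamma (bwt G x B v) *
        (vw G (pinExt G e0 fun i => exp (z i)) v / 2) ^ (-bwt G x B v))) *
        (1 / 2) ^ n) := by
    intro z
    rw [← ENNReal.ofReal_mul (Finset.prod_nonneg fun i _ => (exp_pos _).le),
      ← ENNReal.ofReal_mul (inv_nonneg.2 (mul_pos hZ hC).le),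
      ← prod_exp_mul_prod_rpow he0 B z]
    set w := pinExt G e0 fun i => exp (z i)
    have hwp : ∀ v, 0 < vw G w v := fun v => vw_pos hG he0 (pinExt_pos G fun i => exp_pos _) v
    have hprod : ∏ v, (Gamma (bwt G x B v) * (vw G w v / 2) ^ (-bwt G x B v)) =
        (∏ v, Gamma (bwt G x B v)) * 2 ^ (∑ v, bwt G x B v) *
          ∏ v, vw G w v ^ (-bwt G x B v) := by
      rw [rpow_sum_of_pos two_pos, ← Finset.prod_mul_distrib, ← Finset.prod_mul_distrib]
      refine Finset.prod_congr rfl fun v _ => ?_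
      rw [div_rpow (hwp v).le two_pos.le, rpow_neg two_pos.le, div_inv_eq_mul]
      ring
    rw [magicDensity_eq G x B hwp, hprod, mul_inv]
    have hCC : C⁻¹ * C = 1 := inv_mul_cancel₀ hC.ne'
    congr 1
    rw [hCdef] at hCC ⊢
    linear_combination (-(∏ i, exp (z i)) * (Znorm G x B)⁻¹ *
      ((∏ e ∈ G.edgeFinset, w e ^ (B e - 1)) *
      (∏ v, vw G w v ^ (-bwt G x B v)) * √(tau G w))) * hCC
  simp only [hpt]
  rw [lintegral_const_mul' _ _ ENNReal.ofReal_ne_top, hM, ← hZC,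
    ← ENNReal.ofReal_mul (inv_nonneg.2 (mul_pos hZ hC).le),
    inv_mul_cancel₀ (mul_pos hZ hC).ne', ENNReal.ofReal_one]

end

section

lemma hasDerivAt_log_Gamma {p : ℝ} (hp : 0 < p) :
    HasDerivAt (fun y => log (Gamma y)) (digamma p) p :=
  (((differentiableAt_Gamma fun m => by
    have : (0 : ℝ) ≤ m := m.cast_nonneg
    linarith).log (Gamma_pos_of_pos hp).ne')).hasDerivAt

variable (G : SimpleGraph V) [DecidableRel G.Adj]

lemma vw_add_mul (a F : Sym2 V → ℝ) (t : ℝ) (v : V) :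
    vw G (fun e => a e + t * F e) v = vw G a v + t * vw G F v := by
  simp only [vw, Finset.sum_add_distrib, Finset.mul_sum]

lemma bwt_add_mul (x : V) (a F : Sym2 V → ℝ) (t : ℝ) (v : V) :
    bwt G x (fun e => a e + t * F e) v = bwt G x a v + t * (vw G F v / 2) := by
  rw [bwt, bwt, vw_add_mul]
  ring

variable {G} {e0 : Sym2 V}

lemma log_Znorm (hG : G.Connected) (he0 : e0 ∈ G.edgeFinset)
    {B : Sym2 V → ℝ} (hB : ∀ e ∈ G.edgeFinset, 0 < B e) (x : V) :
    log (Znorm G x B) = ∑ e ∈ G.edgeFinset, log (Gamma (B e)) - ∑ v, log (Gamma (bwt G x B v)) +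
      ((Fintype.card V : ℝ) - 1) / 2 * log π -
      (1 - (Fintype.card V : ℝ) + ∑ e ∈ G.edgeFinset, B e) * log 2 := by
  have h1 : ∀ e ∈ G.edgeFinset, Gamma (B e) ≠ 0 := fun e he => (Gamma_pos_of_pos (hB e he)).ne'
  have h2 : ∀ v ∈ Finset.univ, Gamma (bwt G x B v) ≠ 0 := fun v _ =>
    (Gamma_pos_of_pos (bwt_pos hG he0 hB x v)).ne'
  have h3 := Finset.prod_ne_zero_iff.2 h1
  have h4 := Finset.prod_ne_zero_iff.2 h2
  have h5 := (rpow_pos_of_pos pi_pos (((Fintype.card V : ℝ) - 1) / 2)).ne'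
  have h6 := (rpow_pos_of_pos two_pos
    ((1 : ℝ) - (Fintype.card V : ℝ) + ∑ e ∈ G.edgeFinset, B e)).ne'
  rw [Znorm, log_div (mul_ne_zero (div_ne_zero h3 h4) h5) h6, log_mul (div_ne_zero h3 h4) h5,
    log_div h3 h4, log_prod h1, log_prod h2, log_rpow pi_pos, log_rpow two_pos]

lemma hasDerivAt_log_Znorm (hG : G.Connected) (he0 : e0 ∈ G.edgeFinset)
    {a : Sym2 V → ℝ} (ha : ∀ e ∈ G.edgeFinset, 0 < a e) (F : Sym2 V → ℝ) (x : V)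
    (hF : ∀ᶠ t in nhds (0 : ℝ), ∀ e ∈ G.edgeFinset, 0 < a e + t * F e) :
    HasDerivAt (fun t => log (Znorm G x fun e => a e + t * F e))
      (∑ e ∈ G.edgeFinset, F e *
        (digamma (a e) - ssum (fun v => digamma (bwt G x a v) / 2) e - log 2)) 0 := by
  have hlin : ∀ {p q : ℝ}, 0 < p →
      HasDerivAt (fun t => log (Gamma (p + t * q))) (digamma p * q) 0 := by
    intro p q hp
    have h1 : HasDerivAt (fun t : ℝ => p + t * q) q 0 := by
      simpa using ((hasDerivAt_id (0 : ℝ)).mul_const q).const_add p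
    exact HasDerivAt.comp (h₂ := fun y => log (Gamma y)) 0
      (by simpa using hasDerivAt_log_Gamma hp) h1
  have hs : HasDerivAt (fun t : ℝ => ∑ e ∈ G.edgeFinset, (a e + t * F e))
      (∑ e ∈ G.edgeFinset, F e) 0 :=
    HasDerivAt.fun_sum fun e _ => by
      simpa using ((hasDerivAt_id (0 : ℝ)).mul_const (F e)).const_add (a e)
  have hE : HasDerivAt (fun t => ∑ e ∈ G.edgeFinset, log (Gamma (a e + t * F e)))
      (∑ e ∈ G.edgeFinset, digamma (a e) * F e) 0 :=
    HasDerivAt.fun_sum fun e he => hlin (ha e he)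
  have hV : HasDerivAt (fun t => ∑ v, log (Gamma (bwt G x a v + t * (vw G F v / 2))))
      (∑ v, digamma (bwt G x a v) * (vw G F v / 2)) 0 :=
    HasDerivAt.fun_sum fun v _ => hlin (bwt_pos hG he0 ha x v)
  have hall := ((hE.sub hV).add_const (((Fintype.card V : ℝ) - 1) / 2 * log π)).sub
    ((hs.const_add (1 - (Fintype.card V : ℝ))).mul_const (log 2))
  refine (hall.congr_of_eventuallyEq ?_).congr_deriv ?_
  · filter_upwards [hF] with t ht
    rw [log_Znorm hG he0 ht]
    simp only [bwt_add_mul]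
    rfl
  · have hparts := sum_edge_mul_ssum G F fun v => digamma (bwt G x a v) / 2
    simp only [mul_sub, Finset.sum_sub_distrib, hparts, Finset.sum_mul]
    congr 2
    · exact Finset.sum_congr rfl fun e _ => mul_comm _ _
    · exact Finset.sum_congr rfl fun v _ => by ring

/-- Tilting the magic density by edge and vertex weights amounts to shifting its parameters. -/
lemma exp_mul_magicDensity (hG : G.Connected) (he0 : e0 ∈ G.edgeFinset) (x : V)
    {a F : Sym2 V → ℝ} {t : ℝ} (ha : ∀ e ∈ G.edgeFinset, 0 < a e)
    (hF : ∀ e ∈ G.edgeFinset, 0 < a e + t * F e) {w : Sym2 V → ℝ}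
    (hw : ∀ e ∈ G.edgeFinset, 0 < w e) :
    exp (t * ∑ e ∈ G.edgeFinset, F e * (log (w e) - ssum (fun v => log (vw G w v) / 2) e)) *
      magicDensity G x a w = Znorm G x (fun e => a e + t * F e) / Znorm G x a *
      magicDensity G x (fun e => a e + t * F e) w := by
  have hwp := vw_pos hG he0 hw
  have hZ := (Znorm_pos hG he0 ha x).ne'
  have hZ' := (Znorm_pos hG he0 hF x).ne'
  rw [magicDensity_eq G x _ hwp, magicDensity_eq G x _ hwp]
  have h1 : ∏ e ∈ G.edgeFinset, w e ^ (a e + t * F e - 1) =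
      (∏ e ∈ G.edgeFinset, w e ^ (a e - 1)) * exp (t * ∑ e ∈ G.edgeFinset, F e * log (w e)) := by
    rw [Finset.mul_sum, exp_sum, ← Finset.prod_mul_distrib]
    refine Finset.prod_congr rfl fun e he => ?_
    rw [rpow_def_of_pos (hw e he), rpow_def_of_pos (hw e he), ← exp_add]
    ring_nf
  have h2 : ∏ v, vw G w v ^ (-bwt G x (fun e => a e + t * F e) v) =
      (∏ v, vw G w v ^ (-bwt G x a v)) * exp (-(t * ∑ v, vw G F v * (log (vw G w v) / 2))) := by
    rw [← mul_neg, ← Finset.sum_neg_distrib, Finset.mul_sum, exp_sum, ← Finset.prod_mul_distrib]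
    refine Finset.prod_congr rfl fun v _ => ?_
    rw [rpow_def_of_pos (hwp v), rpow_def_of_pos (hwp v), ← exp_add, bwt_add_mul]
    ring_nf
  have h3 := sum_edge_mul_ssum G F fun v => log (vw G w v) / 2
  simp only [mul_sub, Finset.sum_sub_distrib]
  rw [h1, h2, h3, sub_eq_add_neg, exp_add]
  field_simp

lemma measurable_pinExt (G : SimpleGraph V) [DecidableRel G.Adj] (e0 : Sym2 V) :
    Measurable (pinExt G e0) := by
  refine measurable_pi_lambda _ fun e => ?_
  unfold pinExt
  split_ifs
  · exact measurable_const
  · exact measurable_pi_apply _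
  · exact measurable_const

lemma measurable_vw (G : SimpleGraph V) [DecidableRel G.Adj] (v : V) :
    Measurable fun w : Sym2 V → ℝ => vw G w v :=
  Finset.measurable_sum _ fun _ _ => measurable_pi_apply _

lemma measurable_magicDensity (G : SimpleGraph V) [DecidableRel G.Adj] (x : V)
    (B : Sym2 V → ℝ) : Measurable (magicDensity G x B) := by
  have h1 : Measurable (tau G) :=
    Finset.measurable_sum _ fun _ _ => Finset.measurable_prod _ fun _ _ => measurable_pi_apply _
  have h2 := measurable_vw G
  unfold magicDensity
  fun_prop

lemma measurable_pinned_density (G : SimpleGraph V) [DecidableRel G.Adj] (e0 : Sym2 V) (x : V)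
    (B : Sym2 V → ℝ) : Measurable fun u => ENNReal.ofReal
      (if ∀ e ∈ G.edgeFinset, 0 < pinExt G e0 u e then
        magicDensity G x B (pinExt G e0 u) else 0) := by
  refine ENNReal.measurable_ofReal.comp (Measurable.ite ?_
    ((measurable_magicDensity G x B).comp (measurable_pinExt G e0)) measurable_const)
  simp only [Set.ofPred_forall]
  exact MeasurableSet.iInter fun e => MeasurableSet.iInter fun _ =>
    measurableSet_lt measurable_const ((measurable_pi_apply e).comp (measurable_pinExt G e0))

lemma lintegral_mixing (G : SimpleGraph V) [DecidableRel G.Adj] (e0 : Sym2 V) (x : V)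
    (B : Sym2 V → ℝ) {f : (Sym2 V → ℝ) → ℝ≥0∞} (hf : Measurable f) :
    ∫⁻ w, f w ∂mixing G e0 x B = ∫⁻ u, ENNReal.ofReal
      (if ∀ e ∈ G.edgeFinset, 0 < pinExt G e0 u e then
        magicDensity G x B (pinExt G e0 u) else 0) * f (pinExt G e0 u) := by
  rw [mixing, lintegral_map hf (measurable_pinExt G e0)]
  exact lintegral_withDensity_eq_lintegral_mul _ (measurable_pinned_density G e0 x B)
    (hf.comp (measurable_pinExt G e0))

/-- Exponential moments of logarithmic edge-vertex statistics under the mixing measure. -/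
lemma lintegral_exp_mixing (hG : G.Connected) (he0 : e0 ∈ G.edgeFinset) (x : V)
    {a F : Sym2 V → ℝ} {t : ℝ} (ha : ∀ e ∈ G.edgeFinset, 0 < a e)
    (hF : ∀ e ∈ G.edgeFinset, 0 < a e + t * F e) {ℓ : (Sym2 V → ℝ) → ℝ} (hm : Measurable ℓ)
    (hℓ : ∀ w : Sym2 V → ℝ, (∀ e ∈ G.edgeFinset, 0 < w e) → ℓ w =
      ∑ e ∈ G.edgeFinset, F e * (log (w e) - ssum (fun v => log (vw G w v) / 2) e)) :
    ∫⁻ w, ENNReal.ofReal (exp (t * ℓ w)) ∂mixing G e0 x a =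
      ENNReal.ofReal (Znorm G x (fun e => a e + t * F e) / Znorm G x a) := by
  have hq : 0 ≤ Znorm G x (fun e => a e + t * F e) / Znorm G x a :=
    (div_pos (Znorm_pos hG he0 hF x) (Znorm_pos hG he0 ha x)).le
  rw [lintegral_mixing _ _ _ _ (by fun_prop), ← mul_one (ENNReal.ofReal (_ / _)),
    ← lintegral_magicDensity hG he0 hF x, ← lintegral_const_mul' _ _ ENNReal.ofReal_ne_top]
  refine lintegral_congr fun u => ?_
  rw [← ENNReal.ofReal_mul hq, mul_comm, ← ENNReal.ofReal_mul (exp_pos _).le]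
  congr 1
  split_ifs with h
  · rw [hℓ _ h, exp_mul_magicDensity hG he0 x ha hF h]
  · simp

lemma log_div_sqrt_sprod {f : V → ℝ} (hf : ∀ v, 0 < f v) {c : ℝ} (hc : 0 < c) (e : Sym2 V) :
    log (c / √(sprod f e)) = log c - ssum (fun v => log (f v) / 2) e := by
  induction e using Sym2.ind with
  | _ i j =>
    simp only [sprod, ssum, Sym2.lift_mk]
    rw [log_div hc.ne' (sqrt_pos.2 (mul_pos (hf i) (hf j))).ne', log_sqrt
      (mul_pos (hf i) (hf j)).le, log_mul (hf i).ne' (hf j).ne', add_div]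

lemma measurable_sprod_vw (G : SimpleGraph V) [DecidableRel G.Adj] (e : Sym2 V) :
    Measurable fun w : Sym2 V → ℝ => sprod (vw G w) e := by
  induction e using Sym2.ind with
  | _ i j => exact (measurable_vw G i).mul (measurable_vw G j)

end

/-- For every edge `e = {i,j} ∈ E`,
`∫ log(w_e/√(w_i w_j)) dμ_{v0,A}(w) = Ψ(a_e) − ½Ψ(b_i) − ½Ψ(b_j) − log 2`. -/
theorem mean_of_log_Ye
    {V : Type*} [Fintype V] [DecidableEq V]
    (G : SimpleGraph V) [DecidableRel G.Adj] (hG : G.Connected)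
    (v0 : V) (e0 : Sym2 V) (he0 : e0 ∈ G.edgeFinset)
    (a : Sym2 V → ℝ) (ha : ∀ e ∈ G.edgeFinset, 0 < a e)
    (e : Sym2 V) (he : e ∈ G.edgeFinset) :
    ∫ w, Real.log (w e / Real.sqrt (sprod (vw G w) e)) ∂(mixing G e0 v0 a)
      = digamma (a e) - ssum (fun v => digamma (bwt G v0 a v) / 2) e - Real.log 2 := by
  set ℓ : (Sym2 V → ℝ) → ℝ := fun w => log (w e / √(sprod (vw G w) e)) with hℓdef
  set F : Sym2 V → ℝ := fun e' => if e' = e then 1 else 0 with hFdef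
  have hsum : ∀ f : Sym2 V → ℝ, ∑ e' ∈ G.edgeFinset, F e' * f e' = f e := by
    intro f
    simp [hFdef, SimpleGraph.mem_edgeFinset.1 he]
  have hm : Measurable ℓ :=
    measurable_log.comp ((measurable_pi_apply e).div (measurable_sprod_vw G e).sqrt)
  have hℓ : ∀ w : Sym2 V → ℝ, (∀ e ∈ G.edgeFinset, 0 < w e) → ℓ w =
      ∑ e ∈ G.edgeFinset, F e * (log (w e) - ssum (fun v => log (vw G w v) / 2) e) := by
    intro w hw
    rw [hsum, hℓdef]
    exact log_div_sqrt_sprod (vw_pos hG he0 hw) (hw e he) e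
  have hpos : ∀ t ∈ Set.Ioi (-a e), ∀ e' ∈ G.edgeFinset, 0 < a e' + t * F e' := by
    intro t ht e' he'
    by_cases h : e' = e
    · subst h
      simp only [hFdef, if_true, mul_one]
      linarith [Set.mem_Ioi.1 ht]
    · simpa [hFdef, h] using ha e' he'
  have hnhds : Set.Ioi (-a e) ∈ nhds (0 : ℝ) := Ioi_mem_nhds (neg_lt_zero.2 (ha e he))
  have hmeas : ∀ t, AEStronglyMeasurable (fun w => exp (t * ℓ w)) (mixing G e0 v0 a) := fun t =>
    (hm.const_mul t).exp.aestronglyMeasurable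
  have hlint := fun t ht => lintegral_exp_mixing hG he0 v0 (t := t) ha (hpos t ht) hm hℓ
  have hint : ∀ t ∈ Set.Ioi (-a e), Integrable (fun w => exp (t * ℓ w)) (mixing G e0 v0 a) := by
    intro t ht
    refine ⟨hmeas t, ?_⟩
    rw [hasFiniteIntegral_iff_ofReal (ae_of_all _ fun w => (exp_pos _).le), hlint t ht]
    exact ENNReal.ofReal_lt_top
  have hmgf : ∀ t ∈ Set.Ioi (-a e), ProbabilityTheory.mgf ℓ (mixing G e0 v0 a) t =
      Znorm G v0 (fun e => a e + t * F e) / Znorm G v0 a := by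
    intro t ht
    rw [ProbabilityTheory.mgf, integral_eq_lintegral_of_nonneg_ae
      (ae_of_all _ fun w => (exp_pos _).le) (hmeas t), hlint t ht, ENNReal.toReal_ofReal
      (div_pos (Znorm_pos hG he0 (hpos t ht) v0) (Znorm_pos hG he0 ha v0)).le]
  have hint0 : (0 : ℝ) ∈ interior (ProbabilityTheory.integrableExpSet ℓ (mixing G e0 v0 a)) :=
    mem_interior_iff_mem_nhds.2 (mem_of_superset hnhds hint)
  have hd := hasDerivAt_log_Znorm hG he0 ha F v0
    (mem_of_superset hnhds hpos)
  rw [hsum] at hd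
  have hd' := (hd.sub_const (log (Znorm G v0 a))).exp
  change ∫ w, ℓ w ∂_ = _
  rw [← ProbabilityTheory.deriv_mgf_zero hint0]
  refine ((hd'.congr_of_eventuallyEq ?_).congr_deriv ?_).deriv
  · filter_upwards [hnhds] with t ht
    rw [hmgf t ht, exp_sub, exp_log (Znorm_pos hG he0 (hpos t ht) v0),
      exp_log (Znorm_pos hG he0 ha v0)]
  · simp

end ERRW
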